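/- arXiv:1905.08142 — 3 statements merged into one kernel-verified Lean document; each statement's English description precedes it below -/
import Mathlib

section
/- Let K ⊆ ℝⁿ be a ball-like convex body, equipped with the Lebesgue measure (weight w ≡ 1), and let f be an n-variate real polynomial. Then there exists a constant c > 0 (depending only on K and f) such that for every integer r ≥ 1 one has E^{(r)}_K(f) ≤ c / r^2. -/
open MeasureTheory

noncomputable section

/-- A polynomial is a sum of squares. -/
def IsSOS {n : ℕ} (q : MvPolynomial (Fin n) ℝ) : Prop :=
  ∃ (m : ℕ) (p : Fin m → MvPolynomial (Fin n) ℝ), q = ∑ i, p i ^ 2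

/-- The Lasserre measure-based upper bound `f^{(r)}_{K,w}`: the infimum of
`∫_K f q w dx` over sum-of-squares polynomials `q` of degree at most `2r`
with `∫_K q w dx = 1`. -/
noncomputable def lasserre {n : ℕ} (r : ℕ) (K : Set (EuclideanSpace ℝ (Fin n)))
    (w f : EuclideanSpace ℝ (Fin n) → ℝ) : ℝ :=
  sInf { v : ℝ | ∃ q : MvPolynomial (Fin n) ℝ, IsSOS q ∧ q.totalDegree ≤ 2 * r ∧
    (∫ x in K, MvPolynomial.eval (fun i => x i) q * w x) = 1 ∧
    v = ∫ x in K, f x * MvPolynomial.eval (fun i => x i) q * w x }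

/-- The error `E^{(r)}_{K,w}(f) = f^{(r)}_{K,w} - min_{x ∈ K} f(x)`. -/
noncomputable def lasserreError {n : ℕ} (r : ℕ) (K : Set (EuclideanSpace ℝ (Fin n)))
    (w f : EuclideanSpace ℝ (Fin n) → ℝ) : ℝ :=
  lasserre r K w f - sInf (f '' K)

/-- A convex body `K` is ball-like: there are uniform radii `εi, εc > 0` such that at
every boundary point there is an inscribed tangent ball of radius `εi` contained in `K`
and a circumscribed tangent ball of radius `εc` containing `K`. -/
def BallLike {n : ℕ} (K : Set (EuclideanSpace ℝ (Fin n))) : Prop :=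
  ∃ εi εc : ℝ, 0 < εi ∧ 0 < εc ∧ ∀ x ∈ frontier K,
    (∃ c1 : EuclideanSpace ℝ (Fin n), dist x c1 = εi ∧ Metric.closedBall c1 εi ⊆ K) ∧
    (∃ c2 : EuclideanSpace ℝ (Fin n), dist x c2 = εc ∧ K ⊆ Metric.closedBall c2 εc)

open Polynomial in
/-- A needle polynomial on `[0, 1]`, concentrated near `0` at scale `1 / N ^ 2`. -/
lemma exists_needle_polynomial (m : ℕ) : ∃ p : ℝ[X], p.natDegree ≤ m ∧
    (∀ t : ℝ, 0 ≤ t → t ≤ 1 → p.eval t ^ 2 * (((m + 1 : ℕ) : ℝ) ^ 2 * t) ≤ 1) ∧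
    (∀ t : ℝ, 0 ≤ t → t ≤ 1 / (2 * ((m + 1 : ℕ) : ℝ) ^ 2) →
      (2 / Real.pi) ^ 2 ≤ p.eval t ^ 2) := by
  set N : ℝ := ((m + 1 : ℕ) : ℝ) with hN
  have hN1 : 1 ≤ N := by rw [hN]; push_cast; linarith [Nat.cast_nonneg (α := ℝ) m]
  have hN0 : 0 < N := by linarith
  have hpi := Real.pi_pos
  have key : ∀ t : ℝ, 0 ≤ t → t ≤ 1 →
      (Chebyshev.U ℝ m).eval (1 - t) * Real.sin (Real.arccos (1 - t))
        = Real.sin (N * Real.arccos (1 - t)) := by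
    intro t h0 h1
    have h := Chebyshev.U_real_cos (Real.arccos (1 - t)) m
    rw [Real.cos_arccos (by linarith) (by linarith)] at h
    rw [h, hN]
    push_cast
    rfl
  refine ⟨C N⁻¹ * (Chebyshev.U ℝ m).comp (C 1 - X), ?_, ?_, ?_⟩
  · refine (natDegree_C_mul_le _ _).trans (natDegree_comp_le.trans ?_)
    have h1 : (C (1 : ℝ) - X).natDegree ≤ 1 := by compute_degree
    rw [Chebyshev.natDegree_U_natCast]
    exact (Nat.mul_le_mul_left m h1).trans (by simp)
  · intro t h0 h1
    have hk := key t h0 h1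
    have hs : Real.sin (Real.arccos (1 - t)) ^ 2 = 2 * t - t ^ 2 := by
      rw [Real.sin_sq, Real.cos_arccos (by linarith) (by linarith)]; ring
    have hle := Real.sin_sq_le_one (N * Real.arccos (1 - t))
    rw [← hk, mul_pow, hs] at hle
    have hU := sq_nonneg ((Chebyshev.U ℝ m).eval (1 - t))
    have heq : (C N⁻¹ * (Chebyshev.U ℝ m).comp (C 1 - X)).eval t ^ 2 * (N ^ 2 * t)
        = (Chebyshev.U ℝ m).eval (1 - t) ^ 2 * t := by
      simp only [eval_mul, eval_C, eval_comp, eval_sub, eval_X]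
      field_simp
    rw [heq]
    refine le_trans ?_ hle
    exact mul_le_mul_of_nonneg_left (by nlinarith) hU
  · intro t h0 h1
    have hN2 : (1 : ℝ) ≤ N ^ 2 := one_le_pow₀ hN1
    have ht1 : t ≤ 1 := h1.trans (by rw [div_le_one (by positivity)]; linarith)
    have hev : (C N⁻¹ * (Chebyshev.U ℝ m).comp (C 1 - X)).eval t
        = N⁻¹ * (Chebyshev.U ℝ m).eval (1 - t) := by
      simp only [eval_mul, eval_C, eval_comp, eval_sub, eval_X]
    rw [hev]
    refine pow_le_pow_left₀ (by positivity) ?_ 2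
    rw [inv_mul_eq_div, le_div_iff₀ hN0]
    rcases h0.eq_or_lt with rfl | hpos
    · rw [sub_zero, Chebyshev.U_eval_one]
      have : 2 / Real.pi ≤ 1 := by rw [div_le_one hpi]; exact Real.two_le_pi
      have hNm : (((m : ℤ) : ℝ) + 1) = N := by rw [hN]; push_cast; rfl
      rw [hNm]
      nlinarith
    · have hk := key t h0 ht1
      set θ := Real.arccos (1 - t) with hθ
      have hθ0 : 0 < θ := Real.arccos_pos.2 (by linarith)
      have hθpi : θ ≤ Real.pi := Real.arccos_le_pi _
      have hθ2 : θ ≤ Real.pi / 2 := Real.arccos_le_pi_div_two.2 (by linarith)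
      have hcos : Real.cos θ = 1 - t := Real.cos_arccos (by linarith) (by linarith)
      have hsin : 0 < Real.sin θ := Real.sin_pos_of_pos_of_lt_pi hθ0 (by linarith)
      have hb := Real.cos_le_one_sub_mul_cos_sq (x := θ) (by rw [abs_of_pos hθ0]; exact hθpi)
      have hNθ : N * θ ≤ Real.pi / 2 := by
        refine abs_le_of_sq_le_sq' ?_ (by positivity) |>.2
        rw [hcos] at hb
        have h2 : t * (2 * N ^ 2) ≤ 1 := by rwa [le_div_iff₀ (by positivity)] at h1
        have h3 : 2 / Real.pi ^ 2 * θ ^ 2 ≤ t := by linarith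
        rw [div_mul_eq_mul_div, div_le_iff₀ (by positivity)] at h3
        nlinarith [sq_nonneg N, sq_nonneg Real.pi]
      have hms := Real.mul_le_sin (x := N * θ) (by positivity) hNθ
      rw [← hk] at hms
      have hsl := Real.sin_le hθ0.le
      refine le_of_mul_le_mul_right ?_ hsin
      refine le_trans ?_ hms
      have : 0 < 2 / Real.pi * N := by positivity
      calc 2 / Real.pi * N * Real.sin θ ≤ 2 / Real.pi * N * θ := by gcongr
        _ = _ := by ring

/-- A polynomial agrees with its first-order expansion at a point up to a quadratic error,
uniformly on cubes. -/
lemma exists_first_order_expansion {n : ℕ} (f : MvPolynomial (Fin n) ℝ) (a : Fin n → ℝ) (R : ℝ) :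
    ∃ (b : Fin n → ℝ) (C : ℝ), 0 ≤ C ∧ ∀ x : Fin n → ℝ, (∀ i, |x i - a i| ≤ R) →
      |MvPolynomial.eval x f - MvPolynomial.eval a f - ∑ i, b i * (x i - a i)|
        ≤ C * ∑ i, (x i - a i) ^ 2 := by
  induction f using MvPolynomial.induction_on with
  | C c => exact ⟨0, 0, le_rfl, fun x _ => by simp⟩
  | add p q hp hq =>
    obtain ⟨b, C, hC, h⟩ := hp
    obtain ⟨b', C', hC', h'⟩ := hq
    refine ⟨b + b', C + C', by positivity, fun x hx => ?_⟩
    have e : MvPolynomial.eval x (p + q) - MvPolynomial.eval a (p + q)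
        - ∑ i, (b + b') i * (x i - a i)
        = (MvPolynomial.eval x p - MvPolynomial.eval a p - ∑ i, b i * (x i - a i))
          + (MvPolynomial.eval x q - MvPolynomial.eval a q - ∑ i, b' i * (x i - a i)) := by
      simp only [map_add, Pi.add_apply, add_mul, Finset.sum_add_distrib]
      ring
    rw [e, add_mul]
    exact (abs_add_le _ _).trans (add_le_add (h x hx) (h' x hx))
  | mul_X p j hp =>
    obtain ⟨b, C, hC, h⟩ := hp
    refine ⟨fun i => a j * b i + if i = j then MvPolynomial.eval a p else 0,
      C * (|a j| + |R|) + ∑ i, |b i|, by positivity, fun x hx => ?_⟩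
    have e : MvPolynomial.eval x (p * MvPolynomial.X j) - MvPolynomial.eval a (p * MvPolynomial.X j)
        - ∑ i, (a j * b i + if i = j then MvPolynomial.eval a p else 0) * (x i - a i)
        = (MvPolynomial.eval x p - MvPolynomial.eval a p - ∑ i, b i * (x i - a i)) * x j
          + (∑ i, b i * (x i - a i)) * (x j - a j) := by
      simp only [map_mul, MvPolynomial.eval_X, add_mul, Finset.sum_add_distrib, ite_mul, zero_mul,
        Finset.sum_ite_eq', Finset.mem_univ, if_true, mul_assoc, ← Finset.mul_sum]
      ring
    have hS : ∀ i, (x i - a i) ^ 2 ≤ ∑ i, (x i - a i) ^ 2 := fun i =>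
      Finset.single_le_sum (f := fun i => (x i - a i) ^ 2) (fun _ _ => sq_nonneg _)
        (Finset.mem_univ i)
    have hS0 : 0 ≤ ∑ i, (x i - a i) ^ 2 := Finset.sum_nonneg fun _ _ => sq_nonneg _
    have hxj : |x j| ≤ |a j| + |R| := by
      have h1 := abs_add_le (a j) (x j - a j)
      rw [add_sub_cancel] at h1
      linarith [hx j, le_abs_self R]
    rw [e]
    refine (abs_add_le _ _).trans ?_
    rw [abs_mul, Finset.sum_mul, add_mul]
    refine add_le_add ?_ ?_
    · calc _ ≤ (C * ∑ i, (x i - a i) ^ 2) * (|a j| + |R|) := by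
            gcongr
            exact h x hx
        _ = _ := by ring
    · rw [Finset.sum_mul]
      refine (Finset.abs_sum_le_sum_abs _ _).trans (Finset.sum_le_sum fun i _ => ?_)
      rw [mul_assoc, abs_mul]
      refine mul_le_mul_of_nonneg_left ?_ (abs_nonneg _)
      refine (abs_le.2 ⟨?_, ?_⟩) <;>
        nlinarith [hS i, hS j, sq_nonneg ((x i - a i) + (x j - a j)),
          sq_nonneg ((x i - a i) - (x j - a j))]

/-- Sublevel sets of a function that decreases under homotheties with centre `a`
grow at most polynomially. -/
lemma pow_mul_volume_sublevel_le {n : ℕ} {K : Set (EuclideanSpace ℝ (Fin n))}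
    (hKc : IsCompact K) (hKconv : Convex ℝ K) {a : EuclideanSpace ℝ (Fin n)} (ha : a ∈ K)
    {g : EuclideanSpace ℝ (Fin n) → ℝ}
    (hhom : ∀ x ∈ K, ∀ θ : ℝ, 0 ≤ θ → θ ≤ 1 → g (AffineMap.homothety a θ x) ≤ θ * g x)
    {θ : ℝ} (h0 : 0 ≤ θ) (h1 : θ ≤ 1) (s : ℝ) :
    θ ^ n * volume.real {x ∈ K | g x ≤ s} ≤ volume.real {x ∈ K | g x ≤ θ * s} := by
  have hsub : AffineMap.homothety a θ '' {x ∈ K | g x ≤ s} ⊆ {x ∈ K | g x ≤ θ * s} := by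
    rintro _ ⟨x, ⟨hx, hgx⟩, rfl⟩
    refine ⟨?_, (hhom x hx θ h0 h1).trans (by gcongr)⟩
    rw [AffineMap.homothety_eq_lineMap]
    exact hKconv.lineMap_mem ha hx ⟨h0, h1⟩
  have hfin : volume {x ∈ K | g x ≤ θ * s} ≠ ⊤ :=
    ((measure_mono (Set.sep_subset _ _)).trans_lt hKc.measure_lt_top).ne
  have h := measureReal_mono (μ := volume) hsub hfin
  rw [Measure.real, Measure.addHaar_image_homothety, ENNReal.toReal_mul,
    ENNReal.toReal_ofReal (abs_nonneg _), finrank_euclideanSpace_fin, abs_of_nonneg (by positivity)]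
    at h
  exact h

/-- A density `h` that decays fast in `N ^ 2 * g` and is bounded below for `g ≤ 1 / (2 * N ^ 2)`
gives `g` a mean of order `1 / N ^ 2`. -/
lemma mean_le_of_decay {n : ℕ} {K : Set (EuclideanSpace ℝ (Fin n))}
    (hKc : IsCompact K) (hKconv : Convex ℝ K) (hKi : (interior K).Nonempty)
    {a : EuclideanSpace ℝ (Fin n)} (ha : a ∈ K)
    {g h : EuclideanSpace ℝ (Fin n) → ℝ} (hg : Continuous g) (hh : Continuous h)
    (hg0 : ∀ x ∈ K, 0 ≤ g x) (hg1 : ∀ x ∈ K, g x ≤ 1)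
    (hhom : ∀ x ∈ K, ∀ θ : ℝ, 0 ≤ θ → θ ≤ 1 → g (AffineMap.homothety a θ x) ≤ θ * g x)
    {S : ℕ} (hS : 1 ≤ S) {d : ℝ} (hd : 0 < d) (hh0 : ∀ x ∈ K, 0 ≤ h x)
    (hdecay : ∀ x ∈ K, h x * (S * g x) ^ (n + 3) ≤ 1)
    (hlow : ∀ x ∈ K, g x ≤ 1 / (2 * S) → d ≤ h x) :
    0 < ∫ x in K, h x ∧
      ∫ x in K, g x * h x ≤ (1 + 2 * 4 ^ n / d) / S * ∫ x in K, h x := by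
  have hS0 : (0 : ℝ) < S := by exact_mod_cast hS
  have hS1 : (1 : ℝ) ≤ S := by exact_mod_cast hS
  have hKm : MeasurableSet K := hKc.measurableSet
  have hih : IntegrableOn h K := hh.continuousOn.integrableOn_compact hKc
  have high : IntegrableOn (fun x => g x * h x) K :=
    (hg.mul hh).continuousOn.integrableOn_compact hKc
  set A : ℝ → Set (EuclideanSpace ℝ (Fin n)) := fun s => {x ∈ K | g x ≤ s}
  have hAm : ∀ s, MeasurableSet (A s) := fun s =>
    hKm.inter (measurableSet_le hg.measurable measurable_const)
  have hAK : ∀ s, A s ⊆ K := fun s => Set.sep_subset _ _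
  have hAfin : ∀ s, volume (A s) ≠ ⊤ := fun s =>
    ((measure_mono (hAK s)).trans_lt hKc.measure_lt_top).ne
  set V := volume.real (A (1 / (2 * S)))
  have hvol : ∀ k : ℕ, volume.real (A ((k + 1) / S)) ≤ (2 * (k + 1)) ^ n * V := by
    intro k
    have h2 : (0 : ℝ) < 2 * (k + 1) := by positivity
    have h := pow_mul_volume_sublevel_le hKc hKconv ha hhom (θ := 1 / (2 * (k + 1)))
      (by positivity) (by rw [div_le_one h2]; linarith [Nat.cast_nonneg (α := ℝ) k]) ((k + 1) / S)
    have he : 1 / (2 * ((k : ℝ) + 1)) * ((k + 1) / S) = 1 / (2 * S) := by field_simp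
    rw [he, one_div, inv_pow, inv_mul_le_iff₀ (by positivity)] at h
    exact h
  have hVpos : 0 < V := by
    have hKpos : 0 < volume.real K := by
      refine ENNReal.toReal_pos ?_ hKc.measure_lt_top.ne
      exact (Measure.measure_pos_of_nonempty_interior _ hKi).ne'
    have hKA : K ⊆ A ((S + 1) / S) := fun x hx => ⟨hx, (hg1 x hx).trans (by
      rw [le_div_iff₀ hS0]; linarith)⟩
    have h := (measureReal_mono hKA (hAfin _)).trans (hvol S)
    by_contra hc
    have : (2 * ((S : ℝ) + 1)) ^ n * V ≤ 0 :=
      mul_nonpos_of_nonneg_of_nonpos (by positivity) (not_lt.1 hc)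
    linarith
  have hlowint : d * V ≤ ∫ x in K, h x := by
    have h1 : ∫ x in A (1 / (2 * S)), d ≤ ∫ x in A (1 / (2 * S)), h x :=
      setIntegral_mono_on (integrableOn_const (hAfin _)) (hih.mono_set (hAK _)) (hAm _)
        fun x hx => hlow x hx.1 hx.2
    have h2 : ∫ x in A (1 / (2 * S)), h x ≤ ∫ x in K, h x := by
      refine setIntegral_mono_set hih ?_ (hAK _).eventuallyLE
      filter_upwards [ae_restrict_mem hKm] with x hx using hh0 x hx
    rw [setIntegral_const, smul_eq_mul, mul_comm] at h1
    exact h1.trans h2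
  refine ⟨lt_of_lt_of_le (by positivity) hlowint, ?_⟩
  have hpt : ∀ x ∈ K, S * (g x * h x) ≤ h x + ∑ k ∈ Finset.Icc 1 S,
      (1 / (k : ℝ) ^ (n + 2)) * (A ((k + 1) / S)).indicator (fun _ => (1 : ℝ)) x := by
    intro x hx
    have hgx := hg0 x hx
    have hhx := hh0 x hx
    have hnn : ∀ k ∈ Finset.Icc 1 S, 0 ≤
        (1 / (k : ℝ) ^ (n + 2)) * (A ((k + 1) / S)).indicator (fun _ => (1 : ℝ)) x := fun k _ =>
      mul_nonneg (by positivity) (Set.indicator_nonneg (fun _ _ => zero_le_one) _)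
    rcases le_or_gt (S * g x) 1 with hle | hgt
    · have := Finset.sum_nonneg hnn
      nlinarith
    · have hk1 : 1 ≤ ⌊S * g x⌋₊ := (Nat.one_le_floor_iff _).2 hgt.le
      have hkS : ⌊S * g x⌋₊ ≤ S :=
        Nat.floor_le_of_le (by nlinarith [hg1 x hx])
      have hfl := Nat.floor_le (show 0 ≤ S * g x by positivity)
      have hfl' := Nat.lt_floor_add_one (S * g x)
      set k := ⌊S * g x⌋₊
      have hk0 : (0 : ℝ) < k := by exact_mod_cast hk1
      have hmem : x ∈ A ((k + 1) / S) := ⟨hx, by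
        rw [le_div_iff₀ hS0]; linarith⟩
      have hsingle := Finset.single_le_sum hnn (Finset.mem_Icc.2 ⟨hk1, hkS⟩)
      rw [Set.indicator_of_mem hmem, mul_one] at hsingle
      have hb : S * (g x * h x) ≤ 1 / (k : ℝ) ^ (n + 2) := by
        rw [le_div_iff₀ (by positivity)]
        calc S * (g x * h x) * (k : ℝ) ^ (n + 2) ≤ S * (g x * h x) * (S * g x) ^ (n + 2) := by
              gcongr
          _ = h x * (S * g x) ^ (n + 3) := by ring
          _ ≤ 1 := hdecay x hx
      linarith
  have hind : ∀ k : ℕ, IntegrableOn (fun x => (1 / (k : ℝ) ^ (n + 2)) *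
      (A ((k + 1) / S)).indicator (fun _ => (1 : ℝ)) x) K := fun k =>
    have hone : IntegrableOn (fun _ => (1 : ℝ)) K := integrableOn_const hKc.measure_lt_top.ne
    Integrable.const_mul (hone.indicator (hAm _)) _
  have hmono := setIntegral_mono_on (high.const_mul (S : ℝ))
    (hih.add (integrable_finsetSum (Finset.Icc 1 S) fun k _ => hind k)) hKm
    (by simpa only [Pi.add_apply, Finset.sum_apply] using hpt)
  have hval : ∀ k : ℕ, ∫ x in K, (1 / (k : ℝ) ^ (n + 2)) *
      (A ((k + 1) / S)).indicator (fun _ => (1 : ℝ)) x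
        = 1 / (k : ℝ) ^ (n + 2) * volume.real (A ((k + 1) / S)) := by
    intro k
    rw [integral_const_mul, setIntegral_indicator (hAm _), Set.inter_eq_right.2 (hAK _),
      setIntegral_const, smul_eq_mul, mul_one]
  have hsum : ∑ k ∈ Finset.Icc 1 S, 1 / (k : ℝ) ^ (n + 2) * volume.real (A ((k + 1) / S))
      ≤ 2 * 4 ^ n * V := by
    have hsq : ∑ k ∈ Finset.Icc 1 S, ((k : ℝ) ^ 2)⁻¹ ≤ 2 := by
      have h := sum_Ioo_inv_sq_le (α := ℝ) 0 (S + 1)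
      have hI : Finset.Ioo 0 (S + 1) = Finset.Icc 1 S := by ext k; simp; omega
      rw [hI] at h
      simpa using h
    calc _ ≤ ∑ k ∈ Finset.Icc 1 S, (4 ^ n * V) * ((k : ℝ) ^ 2)⁻¹ := by
          refine Finset.sum_le_sum fun k hk => ?_
          have hk1 : (1 : ℝ) ≤ k := by exact_mod_cast (Finset.mem_Icc.1 hk).1
          have hk0 : (0 : ℝ) < k := by linarith
          have h4 : (2 * ((k : ℝ) + 1)) ^ n ≤ (4 * k) ^ n :=
            pow_le_pow_left₀ (by positivity) (by linarith) n
          calc _ ≤ 1 / (k : ℝ) ^ (n + 2) * ((4 * k) ^ n * V) := by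
                gcongr
                exact (hvol k).trans (by gcongr)
            _ = _ := by
                rw [mul_pow, pow_add]
                field_simp
      _ = (4 ^ n * V) * ∑ k ∈ Finset.Icc 1 S, ((k : ℝ) ^ 2)⁻¹ := by rw [Finset.mul_sum]
      _ ≤ (4 ^ n * V) * 2 := by gcongr
      _ = _ := by ring
  simp only [Pi.add_apply] at hmono
  rw [integral_const_mul, integral_add hih (integrable_finsetSum _ fun k _ => hind k),
    integral_finsetSum _ fun k _ => hind k] at hmono
  simp only [hval] at hmono
  have hVd : V ≤ (∫ x in K, h x) / d := by rw [le_div_iff₀ hd]; linarith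
  have hfin : S * ∫ x in K, g x * h x ≤ (1 + 2 * 4 ^ n / d) * ∫ x in K, h x := by
    have h1 : 2 * 4 ^ n * V ≤ 2 * 4 ^ n * ((∫ x in K, h x) / d) := by gcongr
    have h2 : (1 + 2 * 4 ^ n / d) * ∫ x in K, h x
        = (∫ x in K, h x) + 2 * 4 ^ n * ((∫ x in K, h x) / d) := by ring
    linarith
  rw [div_mul_eq_mul_div, le_div_iff₀ hS0]
  linarith

lemma totalDegree_aeval_le {n : ℕ} (p : Polynomial ℝ) (G : MvPolynomial (Fin n) ℝ) :
    (Polynomial.aeval G p).totalDegree ≤ p.natDegree * G.totalDegree := by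
  rw [Polynomial.aeval_eq_sum_range]
  refine MvPolynomial.totalDegree_finsetSum_le fun i hi => ?_
  refine (MvPolynomial.totalDegree_smul_le _ _).trans ((MvPolynomial.totalDegree_pow _ _).trans ?_)
  exact Nat.mul_le_mul_right _ (Nat.lt_succ_iff.1 (Finset.mem_range.1 hi))

lemma IsSOS.eval_nonneg {n : ℕ} {q : MvPolynomial (Fin n) ℝ} (hq : IsSOS q) (x : Fin n → ℝ) :
    0 ≤ MvPolynomial.eval x q := by
  obtain ⟨m, p, rfl⟩ := hq
  simp only [map_sum, map_pow]
  exact Finset.sum_nonneg fun _ _ => sq_nonneg _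

lemma continuous_eval_euclidean {n : ℕ} (q : MvPolynomial (Fin n) ℝ) :
    Continuous fun x : EuclideanSpace ℝ (Fin n) => MvPolynomial.eval (fun i => x i) q :=
  (MvPolynomial.continuous_eval q).comp (by fun_prop)

/-- Any admissible square, up to normalization, bounds the Lasserre error. -/
lemma lasserreError_le_of_mean_le {n : ℕ} {K : Set (EuclideanSpace ℝ (Fin n))}
    (hKc : IsCompact K) {F : EuclideanSpace ℝ (Fin n) → ℝ} (hF : Continuous F)
    {a : EuclideanSpace ℝ (Fin n)} (ha : a ∈ K) (hmin : ∀ x ∈ K, F a ≤ F x)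
    {r : ℕ} {p : MvPolynomial (Fin n) ℝ} (hp : p.totalDegree ≤ r)
    (hpos : 0 < ∫ x in K, MvPolynomial.eval (fun i => x i) p ^ 2) {e : ℝ}
    (he : ∫ x in K, (F x - F a) * MvPolynomial.eval (fun i => x i) p ^ 2
      ≤ e * ∫ x in K, MvPolynomial.eval (fun i => x i) p ^ 2) :
    lasserreError r K (fun _ => 1) F ≤ e := by
  set I := ∫ x in K, MvPolynomial.eval (fun i => x i) p ^ 2 with hI
  have hsInf : sInf (F '' K) = F a :=
    IsLeast.csInf_eq ⟨Set.mem_image_of_mem F ha, by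
      rintro _ ⟨x, hx, rfl⟩
      exact hmin x hx⟩
  have hcp := continuous_eval_euclidean p
  set s := Real.sqrt I⁻¹ with hs
  have hs2 : s ^ 2 = I⁻¹ := Real.sq_sqrt (inv_nonneg.2 hpos.le)
  have hev : ∀ x : EuclideanSpace ℝ (Fin n),
      MvPolynomial.eval (fun i => x i) ((MvPolynomial.C s * p) ^ 2)
        = I⁻¹ * MvPolynomial.eval (fun i => x i) p ^ 2 := by
    intro x
    rw [map_pow, map_mul, MvPolynomial.eval_C, mul_pow, hs2]
  have hle : lasserre r K (fun _ => 1) F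
      ≤ ∫ x in K, F x * MvPolynomial.eval (fun i => x i) ((MvPolynomial.C s * p) ^ 2) * 1 := by
    refine csInf_le ⟨F a, ?_⟩ ⟨(MvPolynomial.C s * p) ^ 2, ⟨1, fun _ => MvPolynomial.C s * p, by
      simp⟩, ?_, ?_, rfl⟩
    · rintro _ ⟨q, hq, -, hq1, rfl⟩
      have hcq := continuous_eval_euclidean q
      calc F a = ∫ x in K, F a * (MvPolynomial.eval (fun i => x i) q * 1) := by
            rw [integral_const_mul, hq1, mul_one]
        _ ≤ _ := by
            refine setIntegral_mono_on ?_ ?_ hKc.measurableSet fun x hx => ?_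
            · exact (by fun_prop : Continuous _).continuousOn.integrableOn_compact hKc
            · exact (by fun_prop : Continuous _).continuousOn.integrableOn_compact hKc
            · rw [mul_one, mul_one]
              exact mul_le_mul_of_nonneg_right (hmin x hx) (hq.eval_nonneg _)
    · refine (MvPolynomial.totalDegree_pow _ _).trans (Nat.mul_le_mul_left 2 ?_)
      refine (MvPolynomial.totalDegree_mul _ _).trans ?_
      rw [MvPolynomial.totalDegree_C, zero_add]
      exact hp
    · simp only [hev, mul_one]
      rw [integral_const_mul, ← hI, inv_mul_cancel₀ hpos.ne']
  have hval : ∫ x in K, F x * MvPolynomial.eval (fun i => x i) ((MvPolynomial.C s * p) ^ 2) * 1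
      = I⁻¹ * (∫ x in K, (F x - F a) * MvPolynomial.eval (fun i => x i) p ^ 2) + F a := by
    have hsplit : ∫ x in K, (F x - F a) * MvPolynomial.eval (fun i => x i) p ^ 2
        = (∫ x in K, F x * MvPolynomial.eval (fun i => x i) p ^ 2) - F a * I := by
      rw [hI, ← integral_const_mul, ← integral_sub]
      · simp only [sub_mul]
      · exact (by fun_prop : Continuous _).continuousOn.integrableOn_compact hKc
      · exact (by fun_prop : Continuous _).continuousOn.integrableOn_compact hKc
    rw [hsplit]
    simp only [hev, mul_one, mul_left_comm (F _) I⁻¹]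
    rw [integral_const_mul]
    field_simp
    ring
  have hfin : I⁻¹ * (∫ x in K, (F x - F a) * MvPolynomial.eval (fun i => x i) p ^ 2) ≤ e := by
    rw [inv_mul_le_iff₀ hpos, mul_comm]
    exact he
  rw [lasserreError, hsInf]
  linarith

/-- Theorem: for a ball-like convex body `K ⊆ ℝⁿ` equipped with the Lebesgue measure,
the Lasserre error of any polynomial `f` is `O(1/r²)`. -/
theorem stmt4 {n : ℕ}
    (K : Set (EuclideanSpace ℝ (Fin n)))
    (hKc : IsCompact K) (hKconv : Convex ℝ K) (hKi : (interior K).Nonempty)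
    (hKball : BallLike K)
    (f : MvPolynomial (Fin n) ℝ)
    (F : EuclideanSpace ℝ (Fin n) → ℝ)
    (hF : ∀ x : EuclideanSpace ℝ (Fin n), F x = MvPolynomial.eval (fun i => x i) f) :
    ∃ c : ℝ, 0 < c ∧ ∀ r : ℕ, 1 ≤ r →
      lasserreError r K (fun _ => 1) F ≤ c / (r : ℝ) ^ 2 := by
  have hFc : Continuous F := by
    rw [funext hF]
    exact continuous_eval_euclidean f
  have hKne : K.Nonempty := hKi.mono interior_subset
  obtain ⟨a, ha, hmin⟩ := hKc.exists_isMinOn hKne hFc.continuousOn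
  replace hmin : ∀ x ∈ K, F a ≤ F x := fun x hx => hmin hx
  obtain ⟨R, hR⟩ : ∃ R, ∀ x ∈ K, ∀ i, |x i - a i| ≤ R := by
    obtain ⟨R, hR⟩ := hKc.isBounded.subset_closedBall a
    refine ⟨R, fun x hx i => ?_⟩
    have h1 := PiLp.norm_apply_le (x - a) i
    have h2 := hR hx
    rw [Metric.mem_closedBall, dist_eq_norm] at h2
    exact h1.trans h2
  obtain ⟨b, C, hC, hexp⟩ := exists_first_order_expansion f (fun i => a i) R
  set G₀ : MvPolynomial (Fin n) ℝ :=
    ∑ i, MvPolynomial.C (b i) * (MvPolynomial.X i - MvPolynomial.C (a i))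
      + MvPolynomial.C C * ∑ i, (MvPolynomial.X i - MvPolynomial.C (a i)) ^ 2 with hG₀
  have hX : ∀ i, (MvPolynomial.X i - MvPolynomial.C (a i) : MvPolynomial (Fin n) ℝ).totalDegree
      ≤ 1 := fun i => (MvPolynomial.totalDegree_sub_C_le _ _).trans (by simp)
  have hG₀deg : G₀.totalDegree ≤ 2 := by
    refine (MvPolynomial.totalDegree_add _ _).trans (max_le ?_ ?_)
    · refine MvPolynomial.totalDegree_finsetSum_le fun i _ => ?_
      refine (MvPolynomial.totalDegree_mul _ _).trans ?_
      rw [MvPolynomial.totalDegree_C]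
      linarith [hX i]
    · refine (MvPolynomial.totalDegree_mul _ _).trans ?_
      rw [MvPolynomial.totalDegree_C, zero_add]
      refine MvPolynomial.totalDegree_finsetSum_le fun i _ => ?_
      refine (MvPolynomial.totalDegree_pow _ _).trans ?_
      linarith [hX i]
  have hG₀ev : ∀ x : EuclideanSpace ℝ (Fin n), MvPolynomial.eval (fun i => x i) G₀
      = ∑ i, b i * (x i - a i) + C * ∑ i, (x i - a i) ^ 2 := fun x => by simp [hG₀]
  have hFG : ∀ x ∈ K, F x - F a ≤ MvPolynomial.eval (fun i => x i) G₀ := by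
    intro x hx
    have h := (abs_le.1 (hexp (fun i => x i) (hR x hx))).2
    rw [hF x, hF a, hG₀ev]
    linarith
  obtain ⟨B, hB0, hB⟩ : ∃ B : ℝ, 0 < B ∧ ∀ x ∈ K, MvPolynomial.eval (fun i => x i) G₀ ≤ B := by
    obtain ⟨B, hB⟩ := hKc.bddAbove_image (continuous_eval_euclidean G₀).continuousOn
    exact ⟨max B 1, by positivity, fun x hx =>
      (hB (Set.mem_image_of_mem _ hx)).trans (le_max_left _ _)⟩
  set G : MvPolynomial (Fin n) ℝ := MvPolynomial.C B⁻¹ * G₀ with hG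
  have hGdeg : G.totalDegree ≤ 2 := by
    refine (MvPolynomial.totalDegree_mul _ _).trans ?_
    rwa [MvPolynomial.totalDegree_C, zero_add]
  set g : EuclideanSpace ℝ (Fin n) → ℝ := fun x => MvPolynomial.eval (fun i => x i) G with hg
  have hgG₀ : ∀ x, g x = B⁻¹ * MvPolynomial.eval (fun i => x i) G₀ := fun x => by simp [hg, hG]
  have hgF : ∀ x ∈ K, F x - F a ≤ B * g x := fun x hx => by
    rw [hgG₀, mul_inv_cancel_left₀ hB0.ne']
    exact hFG x hx
  have hg0 : ∀ x ∈ K, 0 ≤ g x := fun x hx => by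
    rw [hgG₀]
    exact mul_nonneg (inv_nonneg.2 hB0.le) ((sub_nonneg.2 (hmin x hx)).trans (hFG x hx))
  have hg1 : ∀ x ∈ K, g x ≤ 1 := fun x hx => by
    rw [hgG₀, inv_mul_le_iff₀ hB0, mul_one]
    exact hB x hx
  have hhom : ∀ x ∈ K, ∀ θ : ℝ, 0 ≤ θ → θ ≤ 1 →
      g (AffineMap.homothety a θ x) ≤ θ * g x := by
    intro x _ θ h0 h1
    have hcoord : ∀ i, (AffineMap.homothety a θ x) i - a i = θ * (x i - a i) := fun i => by
      simp [AffineMap.homothety_apply]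
    rw [hgG₀, hgG₀, mul_left_comm]
    refine mul_le_mul_of_nonneg_left ?_ (inv_nonneg.2 hB0.le)
    rw [hG₀ev, hG₀ev]
    simp only [hcoord, mul_pow, mul_left_comm _ θ, ← Finset.mul_sum]
    rw [mul_add, mul_left_comm C]
    have hs : 0 ≤ C * ∑ i, (x i - a i) ^ 2 :=
      mul_nonneg hC (Finset.sum_nonneg fun _ _ => sq_nonneg _)
    have : θ ^ 2 ≤ θ := by nlinarith
    gcongr
  have hgc : Continuous g := continuous_eval_euclidean G
  set d : ℝ := ((2 / Real.pi) ^ 2) ^ (n + 3)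
  have hd0 : 0 < d := by have := Real.pi_pos; positivity
  refine ⟨B * (1 + 2 * 4 ^ n / d) * (2 * (n + 3)) ^ 2, by positivity, fun r hr => ?_⟩
  set m := r / (2 * (n + 3))
  obtain ⟨p, hpdeg, hpdecay, hplow⟩ := exists_needle_polynomial m
  set q : MvPolynomial (Fin n) ℝ := Polynomial.aeval G p ^ (n + 3) with hq
  have hqdeg : q.totalDegree ≤ r := by
    refine (MvPolynomial.totalDegree_pow _ _).trans ?_
    calc (n + 3) * (Polynomial.aeval G p).totalDegree ≤ (n + 3) * (m * 2) :=
          Nat.mul_le_mul_left _ ((totalDegree_aeval_le p G).trans (Nat.mul_le_mul hpdeg hGdeg))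
      _ = m * (2 * (n + 3)) := by ring
      _ ≤ r := Nat.div_mul_le_self _ _
  have hqev : ∀ x : EuclideanSpace ℝ (Fin n), MvPolynomial.eval (fun i => x i) q ^ 2
      = (p.eval (g x) ^ 2) ^ (n + 3) := by
    intro x
    have h : MvPolynomial.eval (fun i => x i) (Polynomial.aeval G p) = p.eval (g x) := by
      rw [Polynomial.aeval_def, Polynomial.hom_eval₂]
      have hc : (MvPolynomial.eval (fun i => x i)).comp
          (algebraMap ℝ (MvPolynomial (Fin n) ℝ)) = RingHom.id ℝ := by
        ext y
        simp [MvPolynomial.algebraMap_eq]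
      rw [hc]
      rfl
    rw [hq, map_pow, h]
    ring
  obtain ⟨hpos, hmean⟩ := mean_le_of_decay hKc hKconv hKi ha hgc
    (h := fun x => MvPolynomial.eval (fun i => x i) q ^ 2)
    ((continuous_eval_euclidean q).pow 2) hg0 hg1 hhom (S := (m + 1) ^ 2) (Nat.one_le_pow _ _
      (Nat.succ_pos m)) hd0 (fun x _ => sq_nonneg _)
    (fun x hx => by
      simp only [hqev]
      rw [← mul_pow]
      have h := hpdecay (g x) (hg0 x hx) (hg1 x hx)
      push_cast at h ⊢
      exact pow_le_one₀ (mul_nonneg (sq_nonneg _) (mul_nonneg (by positivity) (hg0 x hx))) h)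
    (fun x hx hgx => by
      simp only [hqev]
      refine pow_le_pow_left₀ (sq_nonneg _) (hplow (g x) (hg0 x hx) ?_) _
      push_cast at hgx ⊢
      exact hgx)
  refine lasserreError_le_of_mean_le hKc hFc ha hmin hqdeg hpos ?_
  have hqc := continuous_eval_euclidean q
  have hstep : ∫ x in K, (F x - F a) * MvPolynomial.eval (fun i => x i) q ^ 2
      ≤ B * ∫ x in K, g x * MvPolynomial.eval (fun i => x i) q ^ 2 := by
    rw [← integral_const_mul]
    refine setIntegral_mono_on ?_ ?_ hKc.measurableSet fun x hx => ?_
    · exact (by fun_prop : Continuous _).continuousOn.integrableOn_compact hKc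
    · exact (by fun_prop : Continuous _).continuousOn.integrableOn_compact hKc
    · rw [← mul_assoc]
      exact mul_le_mul_of_nonneg_right (hgF x hx) (sq_nonneg _)
  refine hstep.trans ((mul_le_mul_of_nonneg_left hmean hB0.le).trans ?_)
  rw [← mul_assoc]
  refine mul_le_mul_of_nonneg_right ?_ hpos.le
  have hr0 : (0 : ℝ) < r := by exact_mod_cast hr
  have hrm : (r : ℝ) ≤ 2 * (n + 3) * (m + 1) := by
    have h := Nat.lt_mul_div_succ r (show 0 < 2 * (n + 3) by positivity)
    exact_mod_cast h.le
  rw [mul_div_assoc', div_le_div_iff₀ (by positivity) (by positivity)]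
  push_cast
  calc B * (1 + 2 * 4 ^ n / d) * (r : ℝ) ^ 2
      ≤ B * (1 + 2 * 4 ^ n / d) * (2 * (n + 3) * (m + 1)) ^ 2 := by gcongr
    _ = _ := by ring
end
end

section
/- Let Δ = conv{v₀, v₁, …, vₙ} ⊆ ℝⁿ be a full-dimensional simplex (the convex hull of n+1 affinely independent points), equipped with the Lebesgue measure (weight w ≡ 1), and let f be an n-variate real polynomial. Then there exists a constant c > 0 (depending only on Δ and f) such that for every integer r ≥ 1 one has E^{(r)}_Δ(f) ≤ c / r^2. -/
open MeasureTheory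

noncomputable section

/-- The polynomial `V` of degree `N` with `sin θ * V (sin θ ^ 2) = sin ((2 * N + 1) * θ)`. -/
def dirichletPoly (N : ℕ) : Polynomial ℝ :=
  1 + ∑ j ∈ Finset.range N,
    2 * (Polynomial.Chebyshev.T ℝ ((j + 1 : ℕ) : ℤ)).comp (1 - 2 * Polynomial.X)

lemma natDegree_dirichletPoly_le (N : ℕ) : (dirichletPoly N).natDegree ≤ N := by
  refine (Polynomial.natDegree_add_le _ _).trans (max_le (by simp) ?_)
  refine Polynomial.natDegree_sum_le_of_forall_le _ _ fun j hj => ?_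
  have h1 : (1 - 2 * Polynomial.X : Polynomial ℝ).natDegree ≤ 1 := by compute_degree
  have h2 : (Polynomial.Chebyshev.T ℝ ((j + 1 : ℕ) : ℤ)).natDegree = j + 1 := by
    rw [Polynomial.Chebyshev.natDegree_T, Int.natAbs_natCast]
  have h3 : ((2 : Polynomial ℝ)).natDegree = 0 := Polynomial.natDegree_ofNat 2
  refine Polynomial.natDegree_mul_le.trans ?_
  rw [h3, Polynomial.natDegree_comp, h2]
  have := Finset.mem_range.1 hj
  nlinarith

lemma eval_dirichletPoly_sin_sq (N : ℕ) (θ : ℝ) :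
    (dirichletPoly N).eval (Real.sin θ ^ 2) =
      1 + ∑ j ∈ Finset.range N, 2 * Real.cos ((j + 1 : ℕ) * (2 * θ)) := by
  have h : 1 - 2 * Real.sin θ ^ 2 = Real.cos (2 * θ) := by
    rw [Real.cos_two_mul, Real.cos_sq']; ring
  simp only [dirichletPoly, Polynomial.eval_add, Polynomial.eval_one, Polynomial.eval_finsetSum,
    Polynomial.eval_mul, Polynomial.eval_comp, Polynomial.eval_sub, Polynomial.eval_X,
    Polynomial.eval_ofNat, h, Polynomial.Chebyshev.T_real_cos, Int.cast_natCast]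

lemma sin_mul_eval_dirichletPoly (N : ℕ) (θ : ℝ) :
    Real.sin θ * (dirichletPoly N).eval (Real.sin θ ^ 2) = Real.sin ((2 * N + 1) * θ) := by
  rw [eval_dirichletPoly_sin_sq]
  induction N with
  | zero => simp
  | succ N ih =>
    rw [Finset.sum_range_succ, ← add_assoc, mul_add, ih]
    have h1 : (2 * ((N + 1 : ℕ) : ℝ) + 1) * θ = ((N + 1 : ℕ) : ℝ) * (2 * θ) + θ := by ring
    have h2 : (2 * (N : ℝ) + 1) * θ = ((N + 1 : ℕ) : ℝ) * (2 * θ) - θ := by push_cast; ring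
    rw [h1, h2, Real.sin_add, Real.sin_sub]
    ring

lemma exists_sin_sq_eq {t : ℝ} (ht : t ∈ Set.Icc (0 : ℝ) 1) :
    ∃ θ, 0 ≤ θ ∧ θ ≤ Real.pi / 2 ∧ Real.sin θ ^ 2 = t := by
  refine ⟨Real.arcsin √t, Real.arcsin_nonneg.2 (Real.sqrt_nonneg _), Real.arcsin_le_pi_div_two _, ?_⟩
  rw [Real.sin_arcsin (by linarith [Real.sqrt_nonneg t]) (Real.sqrt_le_one.2 ht.2),
    Real.sq_sqrt ht.1]

lemma mul_sq_eval_dirichletPoly_le (N : ℕ) {t : ℝ} (ht : t ∈ Set.Icc (0 : ℝ) 1) :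
    t * (dirichletPoly N).eval t ^ 2 ≤ 1 := by
  obtain ⟨θ, -, -, rfl⟩ := exists_sin_sq_eq ht
  rw [← mul_pow, sin_mul_eval_dirichletPoly]
  exact Real.sin_sq_le_one _

lemma abs_eval_dirichletPoly_le (N : ℕ) {t : ℝ} (ht : t ∈ Set.Icc (0 : ℝ) 1) :
    |(dirichletPoly N).eval t| ≤ 2 * N + 1 := by
  obtain ⟨θ, -, -, rfl⟩ := exists_sin_sq_eq ht
  rw [eval_dirichletPoly_sin_sq]
  refine (abs_add_le _ _).trans ?_
  have h : |∑ j ∈ Finset.range N, 2 * Real.cos ((j + 1 : ℕ) * (2 * θ))| ≤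
      ∑ _j ∈ Finset.range N, (2 : ℝ) := by
    refine (Finset.abs_sum_le_sum_abs _ _).trans (Finset.sum_le_sum fun j _ => ?_)
    rw [abs_mul, abs_two]
    nlinarith [Real.abs_cos_le_one ((j + 1 : ℕ) * (2 * θ))]
  simp only [Finset.sum_const, Finset.card_range, nsmul_eq_mul] at h
  rw [abs_one]
  linarith

lemma le_eval_dirichletPoly (N : ℕ) {t : ℝ} (ht : t ∈ Set.Icc (0 : ℝ) 1)
    (hN : 16 * (N : ℝ) ^ 2 * t ≤ 1) : (N : ℝ) + 1 ≤ (dirichletPoly N).eval t := by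
  obtain ⟨θ, h0, hpi, rfl⟩ := exists_sin_sq_eq ht
  have hs : θ / 2 ≤ Real.sin θ := by
    refine le_trans ?_ (Real.mul_le_sin h0 hpi)
    have : 1 / 2 ≤ 2 / Real.pi := by
      rw [div_le_div_iff₀ two_pos Real.pi_pos]; linarith [Real.pi_le_four]
    nlinarith
  have hθ : 2 * N * θ ≤ 1 := by
    have h2 : 4 * (N * Real.sin θ) ≤ 1 := by
      refine le_of_sq_le_sq ?_ zero_le_one
      linarith
    nlinarith [(Nat.cast_nonneg N : (0 : ℝ) ≤ N)]
  rw [eval_dirichletPoly_sin_sq]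
  have h : ∑ _j ∈ Finset.range N, (1 : ℝ) ≤
      ∑ j ∈ Finset.range N, 2 * Real.cos ((j + 1 : ℕ) * (2 * θ)) := by
    refine Finset.sum_le_sum fun j hj => ?_
    have hj' : ((j + 1 : ℕ) : ℝ) ≤ N := by exact_mod_cast Finset.mem_range.1 hj
    have h3 : ((j + 1 : ℕ) : ℝ) * (2 * θ) ≤ 1 := by nlinarith
    have h4 : 0 ≤ ((j + 1 : ℕ) : ℝ) * (2 * θ) := by positivity
    nlinarith [Real.one_sub_sq_div_two_le_cos (x := ((j + 1 : ℕ) : ℝ) * (2 * θ))]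
  simp only [Finset.sum_const, Finset.card_range, nsmul_eq_mul, mul_one] at h
  linarith
/-- The polynomial measuring the distance to `a ∈ [0, 1)` inside `[0, 1]`: linear at the endpoint
`0`, quadratic at interior points. -/
def gapPoly (a : ℝ) : Polynomial ℝ :=
  if a = 0 then Polynomial.X else (Polynomial.X - Polynomial.C a) ^ 2

lemma eval_gapPoly (a t : ℝ) : (gapPoly a).eval t = if a = 0 then t else (t - a) ^ 2 := by
  unfold gapPoly
  split_ifs <;> simp

lemma natDegree_gapPoly_le (a : ℝ) : (gapPoly a).natDegree ≤ 2 := by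
  unfold gapPoly
  split_ifs
  · simp
  · refine Polynomial.natDegree_pow_le.trans ?_
    simp

lemma eval_gapPoly_mem_Icc {a t : ℝ} (ha : a ∈ Set.Ico (0 : ℝ) 1) (ht : t ∈ Set.Icc (0 : ℝ) 1) :
    (gapPoly a).eval t ∈ Set.Icc (0 : ℝ) 1 := by
  rw [eval_gapPoly]
  split_ifs
  · exact ht
  · exact ⟨sq_nonneg _, by nlinarith [ha.1, ha.2, ht.1, ht.2]⟩

lemma sq_sub_le_eval_gapPoly {a t : ℝ} (ht : t ∈ Set.Icc (0 : ℝ) 1) :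
    (t - a) ^ 2 ≤ (gapPoly a).eval t := by
  rw [eval_gapPoly]
  split_ifs with h
  · subst h; nlinarith [ht.1, ht.2]
  · exact le_rfl

/-- A univariate polynomial whose square is concentrated near `a` on `[0, 1]`. -/
def peakPoly (a : ℝ) (N : ℕ) : Polynomial ℝ := (dirichletPoly N).comp (gapPoly a) ^ 3

lemma natDegree_peakPoly_le (a : ℝ) (N : ℕ) : (peakPoly a N).natDegree ≤ 6 * N := by
  refine Polynomial.natDegree_pow_le.trans ?_
  rw [Polynomial.natDegree_comp]
  have := Nat.mul_le_mul (natDegree_dirichletPoly_le N) (natDegree_gapPoly_le a)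
  omega

lemma eval_peakPoly_sq (a t : ℝ) (N : ℕ) :
    (peakPoly a N).eval t ^ 2 = ((dirichletPoly N).eval ((gapPoly a).eval t)) ^ 6 := by
  simp only [peakPoly, Polynomial.eval_pow, Polynomial.eval_comp]
  ring

lemma mul_eval_dirichletPoly_pow_le (N : ℕ) {h : ℝ} (hh : h ∈ Set.Icc (0 : ℝ) 1) :
    h * (dirichletPoly N).eval h ^ 6 ≤ 8 / (h + 1 / (4 * ((N : ℝ) + 1) ^ 2)) ^ 2 := by
  have hm : (0 : ℝ) < (N : ℝ) + 1 := by positivity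
  set m : ℝ := (N : ℝ) + 1 with hmdef
  set ε : ℝ := 1 / (4 * m ^ 2) with hε
  have hεpos : 0 < ε := by positivity
  have h0 := hh.1
  set V := (dirichletPoly N).eval h
  have h1 : h * V ^ 2 ≤ 1 := mul_sq_eval_dirichletPoly_le N hh
  have h2 : V ^ 2 ≤ 4 * m ^ 2 := by
    have h3 : |V| ≤ 2 * m := (abs_eval_dirichletPoly_le N hh).trans (by rw [hmdef]; linarith)
    rw [← sq_abs]
    nlinarith [abs_nonneg V]
  have h3 : ε * V ^ 2 ≤ 1 := by
    have : ε * (4 * m ^ 2) = 1 := by rw [hε]; field_simp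
    nlinarith
  have h4 : (h + ε) * V ^ 2 ≤ 2 := by nlinarith
  have h5 : ((h + ε) * V ^ 2) ^ 3 ≤ 2 ^ 3 := pow_le_pow_left₀ (by positivity) h4 3
  rw [le_div_iff₀ (by positivity)]
  calc h * V ^ 6 * (h + ε) ^ 2 ≤ (h + ε) * V ^ 6 * (h + ε) ^ 2 := by gcongr; linarith
    _ = ((h + ε) * V ^ 2) ^ 3 := by ring
    _ ≤ 8 := by linarith

lemma mul_le_setIntegral_Icc {g : ℝ → ℝ} (hg : Continuous g) (hg0 : ∀ t, 0 ≤ g t) {u v B : ℝ}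
    (hu : 0 ≤ u) (huv : u ≤ v) (hv : v ≤ 1) (hB : ∀ t ∈ Set.Icc u v, B ≤ g t) :
    (v - u) * B ≤ ∫ t in Set.Icc (0 : ℝ) 1, g t := by
  have h1 : ∫ _t in Set.Icc u v, B = (v - u) * B := by
    simp [huv]
  rw [← h1]
  refine (setIntegral_mono_on continuous_const.integrableOn_Icc hg.integrableOn_Icc
    measurableSet_Icc hB).trans ?_
  exact setIntegral_mono_set hg.integrableOn_Icc (Filter.Eventually.of_forall hg0)
    (Filter.Eventually.of_forall (Set.Icc_subset_Icc hu hv))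

lemma le_setIntegral_peakPoly_sq {a : ℝ} (ha : a ∈ Set.Ico (0 : ℝ) 1) {N : ℕ}
    (hN : 1 ≤ N * (1 - a)) {δ : ℝ} (hδ0 : 0 ≤ δ) (hδ1 : δ ≤ 1 / (4 * ((N : ℝ) + 1)))
    (hδ : ∀ t ∈ Set.Icc a (a + δ), (gapPoly a).eval t ≤ 1 / (16 * ((N : ℝ) + 1) ^ 2)) :
    δ * ((N : ℝ) + 1) ^ 6 ≤ ∫ t in Set.Icc (0 : ℝ) 1, (peakPoly a N).eval t ^ 2 := by
  have hm : (0 : ℝ) < (N : ℝ) + 1 := by positivity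
  have hδ2 : a + δ ≤ 1 := by
    have : 1 / (4 * ((N : ℝ) + 1)) ≤ 1 - a := by
      rw [div_le_iff₀ (by positivity)]
      nlinarith [ha.2]
    linarith
  have := mul_le_setIntegral_Icc (g := fun t => (peakPoly a N).eval t ^ 2) (B := ((N : ℝ) + 1) ^ 6)
    (by fun_prop) (fun t => sq_nonneg _) ha.1 (le_add_of_nonneg_right hδ0) hδ2 (fun t ht => by
      have ht' : t ∈ Set.Icc (0 : ℝ) 1 := ⟨ha.1.trans ht.1, ht.2.trans hδ2⟩
      have hg := eval_gapPoly_mem_Icc ha ht'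
      rw [eval_peakPoly_sq]
      refine pow_le_pow_left₀ hm.le (le_eval_dirichletPoly N hg ?_) 6
      have h1 := hδ t ht
      rw [le_div_iff₀ (by positivity)] at h1
      nlinarith [hg.1, (Nat.cast_nonneg N : (0 : ℝ) ≤ N)])
  simpa using this

lemma setIntegral_eval_gapPoly_mul_peakPoly_sq_le {a : ℝ} (ha : a ∈ Set.Ico (0 : ℝ) 1) {N : ℕ}
    {g : ℝ → ℝ} {G : ℝ → ℝ} (hG : ∀ t ∈ Set.Icc (0 : ℝ) 1, HasDerivAt G (g t) t)
    (hg : ContinuousOn g (Set.Icc 0 1))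
    (h : ∀ t ∈ Set.Icc (0 : ℝ) 1,
      8 / ((gapPoly a).eval t + 1 / (4 * ((N : ℝ) + 1) ^ 2)) ^ 2 ≤ g t) :
    ∫ t in Set.Icc (0 : ℝ) 1, (gapPoly a).eval t * (peakPoly a N).eval t ^ 2 ≤ G 1 - G 0 := by
  rw [← intervalIntegral.integral_eq_sub_of_hasDerivAt 
    (fun t ht => hG t (by rwa [Set.uIcc_of_le zero_le_one] at ht))
    (hg.intervalIntegrable_of_Icc zero_le_one), intervalIntegral.integral_of_le zero_le_one,
    ← integral_Icc_eq_integral_Ioc]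
  refine setIntegral_mono_on (Continuous.integrableOn_Icc (by fun_prop)) hg.integrableOn_Icc
    measurableSet_Icc fun t ht => ?_
  rw [eval_peakPoly_sq]
  exact (mul_eval_dirichletPoly_pow_le N (eval_gapPoly_mem_Icc ha ht)).trans (h t ht)

lemma peakPoly_zero_estimate {N : ℕ} (hN : 1 ≤ N) :
    0 < ∫ t in Set.Icc (0 : ℝ) 1, (peakPoly 0 N).eval t ^ 2 ∧
    ∫ t in Set.Icc (0 : ℝ) 1, (gapPoly 0).eval t * (peakPoly 0 N).eval t ^ 2 ≤
      1024 / ((N : ℝ) + 1) ^ 2 * ∫ t in Set.Icc (0 : ℝ) 1, (peakPoly 0 N).eval t ^ 2 := by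
  have h0 : (0 : ℝ) ∈ Set.Ico (0 : ℝ) 1 := by simp
  have hN' : (1 : ℝ) ≤ N := by exact_mod_cast hN
  set m : ℝ := (N : ℝ) + 1 with hmdef
  have hm : 1 ≤ m := by linarith
  have hlow := le_setIntegral_peakPoly_sq h0 (N := N) (by simpa using hN')
    (δ := 1 / (16 * m ^ 2)) (by positivity)
    (by
      rw [← hmdef]
      refine one_div_le_one_div_of_le (by positivity) ?_
      nlinarith)
    (fun t ht => by simpa [eval_gapPoly] using ht.2)
  have hup := setIntegral_eval_gapPoly_mul_peakPoly_sq_le h0 (N := N)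
    (g := fun t => 8 / (t + 1 / (4 * m ^ 2)) ^ 2) (G := fun t => -8 * (t + 1 / (4 * m ^ 2))⁻¹)
    (fun t ht => by
      have hne : t + 1 / (4 * m ^ 2) ≠ 0 := by
        have : 0 < 1 / (4 * m ^ 2) := by positivity
        linarith [ht.1]
      have := (((hasDerivAt_id' t).add_const (1 / (4 * m ^ 2))).inv hne).const_mul (-8)
      refine this.congr_deriv ?_
      ring)
    (by
      refine ContinuousOn.div (by fun_prop) (by fun_prop) fun t ht => ?_
      have : 0 < 1 / (4 * m ^ 2) := by positivity
      have := ht.1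
      positivity)
    (fun t ht => by simp [eval_gapPoly, hmdef])
  rw [← hmdef] at hlow
  set I := ∫ t in Set.Icc (0 : ℝ) 1, (peakPoly 0 N).eval t ^ 2
  have h1 : 1 / (16 * m ^ 2) * m ^ 6 = m ^ 4 / 16 := by field_simp
  rw [h1] at hlow
  refine ⟨lt_of_lt_of_le (by positivity) hlow, hup.trans ?_⟩
  have h2 : 1024 / m ^ 2 * (m ^ 4 / 16) ≤ 1024 / m ^ 2 * I := by gcongr
  have h3 : 1024 / m ^ 2 * (m ^ 4 / 16) = 64 * m ^ 2 := by field_simp; norm_num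
  have h4 : (0 + 1 / (4 * m ^ 2))⁻¹ = 4 * m ^ 2 := by rw [zero_add, one_div, inv_inv]
  have h5 : 0 ≤ (1 + 1 / (4 * m ^ 2))⁻¹ := by positivity
  simp only [h4]
  nlinarith

lemma peakPoly_pos_estimate {a : ℝ} (ha0 : 0 < a) (ha1 : a < 1) {N : ℕ} (hN : 1 ≤ N * (1 - a)) :
    0 < ∫ t in Set.Icc (0 : ℝ) 1, (peakPoly a N).eval t ^ 2 ∧
    ∫ t in Set.Icc (0 : ℝ) 1, (gapPoly a).eval t * (peakPoly a N).eval t ^ 2 ≤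
      1024 / ((N : ℝ) + 1) ^ 2 * ∫ t in Set.Icc (0 : ℝ) 1, (peakPoly a N).eval t ^ 2 := by
  have ha : a ∈ Set.Ico (0 : ℝ) 1 := ⟨ha0.le, ha1⟩
  set m : ℝ := (N : ℝ) + 1 with hmdef
  have hm : 0 < m := by positivity
  have hlow := le_setIntegral_peakPoly_sq ha hN
    (δ := 1 / (4 * m)) (by positivity) le_rfl
    (fun t ht => by
      rw [eval_gapPoly, if_neg ha0.ne', ← hmdef]
      have h1 : 0 ≤ t - a := by linarith [ht.1]
      have h2 : t - a ≤ 1 / (4 * m) := by linarith [ht.2]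
      calc (t - a) ^ 2 ≤ (1 / (4 * m)) ^ 2 := pow_le_pow_left₀ h1 h2 2
        _ = 1 / (16 * m ^ 2) := by rw [div_pow]; ring)
  have hup := setIntegral_eval_gapPoly_mul_peakPoly_sq_le ha (N := N)
    (g := fun t => 64 * m ^ 3 * (1 / (1 + (2 * m * (t - a)) ^ 2) * (2 * m)))
    (G := fun t => 64 * m ^ 3 * Real.arctan (2 * m * (t - a)))
    (fun t ht => by
      have h1 : HasDerivAt (fun t : ℝ => 2 * m * (t - a)) (2 * m) t := by
        simpa using ((hasDerivAt_id' t).sub_const a).const_mul (2 * m)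
      exact (h1.arctan).const_mul _)
    (by
      refine Continuous.continuousOn ?_
      have : ∀ t : ℝ, 1 + (2 * m * (t - a)) ^ 2 ≠ 0 := fun t => by positivity
      fun_prop (disch := assumption))
    (fun t ht => by
      rw [eval_gapPoly, if_neg ha0.ne', ← hmdef]
      have h1 : (t - a) ^ 2 + 1 / (4 * m ^ 2) = (1 + (2 * m * (t - a)) ^ 2) / (4 * m ^ 2) := by
        field_simp; ring
      have h2 : 64 * m ^ 3 * (1 / (1 + (2 * m * (t - a)) ^ 2) * (2 * m)) =
          128 * m ^ 4 / (1 + (2 * m * (t - a)) ^ 2) := by field_simp; ring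
      have h3 : 8 / ((1 + (2 * m * (t - a)) ^ 2) / (4 * m ^ 2)) ^ 2 =
          128 * m ^ 4 / (1 + (2 * m * (t - a)) ^ 2) ^ 2 := by field_simp; norm_num
      rw [h1, h2, h3]
      refine div_le_div_of_nonneg_left (by positivity) (by positivity) ?_
      nlinarith [sq_nonneg (2 * m * (t - a))])
  rw [← hmdef] at hlow
  set I := ∫ t in Set.Icc (0 : ℝ) 1, (peakPoly a N).eval t ^ 2
  have h1 : 1 / (4 * m) * m ^ 6 = m ^ 5 / 4 := by field_simp
  rw [h1] at hlow
  refine ⟨lt_of_lt_of_le (by positivity) hlow, hup.trans ?_⟩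
  have h2 : 1024 / m ^ 2 * (m ^ 5 / 4) ≤ 1024 / m ^ 2 * I := by gcongr
  have h3 : 1024 / m ^ 2 * (m ^ 5 / 4) = 256 * m ^ 3 := by field_simp; norm_num
  rw [h3] at h2
  refine le_trans ?_ h2
  rw [← mul_sub]
  have h4 := Real.arctan_lt_pi_div_two (2 * m * (1 - a))
  have h5 := Real.neg_pi_div_two_lt_arctan (2 * m * (0 - a))
  have h6 : Real.arctan (2 * m * (1 - a)) - Real.arctan (2 * m * (0 - a)) ≤ 4 := by
    linarith [Real.pi_le_four]
  have h7 : 0 < m ^ 3 := by positivity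
  nlinarith

lemma peakPoly_estimate {a : ℝ} (ha : a ∈ Set.Ico (0 : ℝ) 1) {N : ℕ} (hN : 1 ≤ N * (1 - a)) :
    0 < ∫ t in Set.Icc (0 : ℝ) 1, (peakPoly a N).eval t ^ 2 ∧
    ∫ t in Set.Icc (0 : ℝ) 1, (gapPoly a).eval t * (peakPoly a N).eval t ^ 2 ≤
      1024 / ((N : ℝ) + 1) ^ 2 * ∫ t in Set.Icc (0 : ℝ) 1, (peakPoly a N).eval t ^ 2 := by
  rcases ha.1.eq_or_lt with rfl | h0
  · refine peakPoly_zero_estimate ?_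
    have : (1 : ℝ) ≤ N := by simpa using hN
    exact_mod_cast this
  · exact peakPoly_pos_estimate h0 ha.2 hN

/-- The unit cube. -/
def unitCube (ι : Type*) : Set (ι → ℝ) := Set.univ.pi fun _ => Set.Icc (0 : ℝ) 1

lemma isCompact_unitCube {ι : Type*} : IsCompact (unitCube ι) :=
  isCompact_univ_pi fun _ => isCompact_Icc

section Cube

variable {ι : Type*} [Fintype ι]

/-- The sum of the coordinatewise gaps to the point `a`. -/
def gapSum (a : ι → ℝ) (t : ι → ℝ) : ℝ := ∑ i, (gapPoly (a i)).eval (t i)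

/-- The product density concentrated near the point `a`. -/
def peakDensity (a : ι → ℝ) (N : ℕ) (t : ι → ℝ) : ℝ := ∏ i, (peakPoly (a i) N).eval (t i) ^ 2

lemma continuous_gapSum (a : ι → ℝ) : Continuous (gapSum a) := by
  unfold gapSum; fun_prop

lemma continuous_peakDensity (a : ι → ℝ) (N : ℕ) : Continuous (peakDensity a N) := by
  unfold peakDensity; fun_prop

lemma peakDensity_nonneg (a : ι → ℝ) (N : ℕ) (t : ι → ℝ) : 0 ≤ peakDensity a N t :=
  Finset.prod_nonneg fun _ _ => sq_nonneg _

lemma volume_restrict_unitCube :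
    (volume : Measure (ι → ℝ)).restrict (unitCube ι) =
      Measure.pi fun _ : ι => (volume : Measure ℝ).restrict (Set.Icc 0 1) := by
  rw [volume_pi, unitCube, Measure.restrict_pi_pi]

lemma peakDensity_cube_estimate {a : ι → ℝ} (ha : ∀ i, a i ∈ Set.Ico (0 : ℝ) 1) {N : ℕ}
    (hN : ∀ i, 1 ≤ N * (1 - a i)) :
    0 < ∫ t in unitCube ι, peakDensity a N t ∧
    ∫ t in unitCube ι, gapSum a t * peakDensity a N t ≤
      Fintype.card ι * (1024 / ((N : ℝ) + 1) ^ 2) * ∫ t in unitCube ι, peakDensity a N t := by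
  classical
  set I : ι → ℝ := fun i => ∫ t in Set.Icc (0 : ℝ) 1, (peakPoly (a i) N).eval t ^ 2 with hI
  have hest := fun i => peakPoly_estimate (ha i) (hN i)
  have hpos : ∀ i, 0 < I i := fun i => (hest i).1
  have hprod : ∫ t in unitCube ι, peakDensity a N t = ∏ i, I i := by
    rw [volume_restrict_unitCube]
    exact integral_fintype_prod_eq_prod fun i t => (peakPoly (a i) N).eval t ^ 2
  have hone : ∀ k, ∫ t in unitCube ι, (gapPoly (a k)).eval (t k) * peakDensity a N t ≤
      1024 / ((N : ℝ) + 1) ^ 2 * ∏ i, I i := by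
    intro k
    have h1 : ∀ t : ι → ℝ, (gapPoly (a k)).eval (t k) * peakDensity a N t =
        ∏ i, (if i = k then (gapPoly (a i)).eval (t i) else 1) *
          (peakPoly (a i) N).eval (t i) ^ 2 := by
      intro t
      rw [Finset.prod_mul_distrib, peakDensity]
      simp
    simp_rw [h1]
    rw [volume_restrict_unitCube, integral_fintype_prod_eq_prod fun i t =>
      (if i = k then (gapPoly (a i)).eval t else 1) * (peakPoly (a i) N).eval t ^ 2,
      ← Finset.mul_prod_erase _ _ (Finset.mem_univ k),
      ← Finset.mul_prod_erase _ _ (Finset.mem_univ k), ← mul_assoc]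
    have h2 : ∏ i ∈ Finset.univ.erase k, ∫ t in Set.Icc (0 : ℝ) 1,
        (if i = k then (gapPoly (a i)).eval t else 1) * (peakPoly (a i) N).eval t ^ 2 =
        ∏ i ∈ Finset.univ.erase k, I i := by
      refine Finset.prod_congr rfl fun i hi => ?_
      simp [(Finset.mem_erase.1 hi).1, hI]
    rw [h2]
    refine mul_le_mul_of_nonneg_right ?_ (Finset.prod_nonneg fun i _ => (hpos i).le)
    simpa using (hest k).2
  rw [hprod]
  refine ⟨Finset.prod_pos fun i _ => hpos i, ?_⟩
  simp_rw [gapSum, Finset.sum_mul]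
  rw [integral_finsetSum _ fun i _ => ContinuousOn.integrableOn_compact isCompact_unitCube
    (Continuous.continuousOn (by have := continuous_peakDensity a N; fun_prop))]
  refine (Finset.sum_le_sum fun k _ => hone k).trans ?_
  simp [mul_assoc]

/-- The corner simplex `{t ≥ 0, ∑ t ≤ 1}`. -/
def cornerSimplex (ι : Type*) [Fintype ι] : Set (ι → ℝ) := {t | (∀ i, 0 ≤ t i) ∧ ∑ i, t i ≤ 1}

lemma cornerSimplex_subset_unitCube : cornerSimplex ι ⊆ unitCube ι := fun _ ht i _ =>
  ⟨ht.1 i, (Finset.single_le_sum (fun j _ => ht.1 j) (Finset.mem_univ i)).trans ht.2⟩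

lemma isClosed_cornerSimplex : IsClosed (cornerSimplex ι) := by
  have : cornerSimplex ι = (⋂ i, {t | 0 ≤ t i}) ∩ {t | ∑ i, t i ≤ 1} := by
    ext t; simp [cornerSimplex]
  rw [this]
  exact (isClosed_iInter fun i => isClosed_le continuous_const (continuous_apply i)).inter
    (isClosed_le (by fun_prop) continuous_const)

lemma gapSum_nonneg {a t : ι → ℝ} (ht : t ∈ unitCube ι) : 0 ≤ gapSum a t :=
  Finset.sum_nonneg fun i _ => (sq_nonneg _).trans (sq_sub_le_eval_gapPoly (ht i trivial))

lemma sq_sum_sub_le_gapSum {a t : ι → ℝ} (ht : t ∈ unitCube ι) :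
    (∑ i, (t i - a i)) ^ 2 ≤ Fintype.card ι * gapSum a t := by
  refine (sq_sum_le_card_mul_sum_sq (s := Finset.univ) (f := fun i => t i - a i)).trans ?_
  rw [Finset.card_univ]
  exact mul_le_mul_of_nonneg_left
    (Finset.sum_le_sum fun i _ => sq_sub_le_eval_gapPoly (ht i trivial)) (Nat.cast_nonneg _)

lemma peakDensity_cornerSimplex_estimate {a : ι → ℝ} (ha0 : ∀ i, 0 ≤ a i) (ha1 : ∑ i, a i < 1) :
    ∃ c : ℝ, ∃ M : ℕ, 0 ≤ c ∧ ∀ N : ℕ, M ≤ N →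
      0 < ∫ t in cornerSimplex ι, peakDensity a N t ∧
      ∫ t in cornerSimplex ι, gapSum a t * peakDensity a N t ≤
        c / (N : ℝ) ^ 2 * ∫ t in cornerSimplex ι, peakDensity a N t := by
  set δ : ℝ := 1 - ∑ i, a i with hδdef
  have hδ : 0 < δ := by linarith
  set d : ℝ := (Fintype.card ι : ℝ) with hd
  have hd0 : 0 ≤ d := Nat.cast_nonneg _
  have hai : ∀ i, δ ≤ 1 - a i := fun i => by
    have := Finset.single_le_sum (fun j _ => ha0 j) (Finset.mem_univ i)
    linarith
  set K : ℝ := d / δ ^ 2 with hK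
  have hK0 : 0 ≤ K := by positivity
  obtain ⟨M, hM⟩ := exists_nat_ge (1 / δ + 2 * (K * (d * 1024)) + 1)
  refine ⟨2 * (d * 1024), M, by positivity, fun N hMN => ?_⟩
  have hN : 1 / δ + 2 * (K * (d * 1024)) + 1 ≤ N := hM.trans (by exact_mod_cast hMN)
  have hpos : 0 < 1 / δ := by positivity
  have hX : 0 ≤ K * (d * 1024) := by positivity
  have hN1 : (1 : ℝ) ≤ N := by linarith
  have hNδ : 1 ≤ N * δ := by
    have h1 : 1 / δ ≤ N := by linarith
    rwa [div_le_iff₀ hδ] at h1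
  obtain ⟨hI, hH⟩ := peakDensity_cube_estimate (a := a) (N := N)
    (fun i => ⟨ha0 i, by linarith [hai i]⟩)
    (fun i => hNδ.trans (mul_le_mul_of_nonneg_left (hai i) (Nat.cast_nonneg _)))
  set I := ∫ t in unitCube ι, peakDensity a N t with hIdef
  set κ : ℝ := d * (1024 / ((N : ℝ) + 1) ^ 2) with hκ
  have hκ1 : κ ≤ d * 1024 / (N : ℝ) ^ 2 := by
    rw [hκ, mul_div_assoc]
    gcongr
    linarith
  have hQ := continuous_peakDensity a N
  have hS := continuous_gapSum a
  have hint : ∀ g : (ι → ℝ) → ℝ, Continuous g → IntegrableOn g (unitCube ι) := fun g hg =>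
    hg.continuousOn.integrableOn_compact isCompact_unitCube
  have hmeas : MeasurableSet (cornerSimplex ι) := isClosed_cornerSimplex.measurableSet
  have hlow : I - K * ∫ t in unitCube ι, gapSum a t * peakDensity a N t ≤
      ∫ t in cornerSimplex ι, peakDensity a N t := by
    rw [hIdef, ← integral_const_mul, ← integral_sub (hint _ hQ) (hint _ (by fun_prop)),
      ← Set.inter_eq_self_of_subset_right (cornerSimplex_subset_unitCube (ι := ι)),
      ← setIntegral_indicator hmeas]
    refine setIntegral_mono_on (hint _ (by fun_prop)) ((hint _ hQ).indicator hmeas)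
      isCompact_unitCube.measurableSet fun t ht => ?_
    have hq := peakDensity_nonneg a N t
    have hg := gapSum_nonneg (a := a) ht
    by_cases htT : t ∈ cornerSimplex ι
    · rw [Set.indicator_of_mem htT]
      have : 0 ≤ K * (gapSum a t * peakDensity a N t) := by positivity
      linarith
    · rw [Set.indicator_of_notMem htT]
      have h1 : 1 < ∑ i, t i := by
        by_contra hcon
        exact htT ⟨fun i => (ht i trivial).1, not_lt.1 hcon⟩
      have h2 : δ ≤ ∑ i, (t i - a i) := by rw [Finset.sum_sub_distrib]; linarith
      have h3 := (pow_le_pow_left₀ hδ.le h2 2).trans (sq_sum_sub_le_gapSum ht)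
      have h4 : 1 ≤ K * gapSum a t := by
        rw [hK, div_mul_eq_mul_div, le_div_iff₀ (by positivity)]
        linarith
      nlinarith
  have hup : ∫ t in cornerSimplex ι, gapSum a t * peakDensity a N t ≤
      ∫ t in unitCube ι, gapSum a t * peakDensity a N t := by
    refine setIntegral_mono_set (hint _ (by fun_prop)) ?_
      (Filter.Eventually.of_forall cornerSimplex_subset_unitCube)
    filter_upwards [ae_restrict_mem isCompact_unitCube.measurableSet] with t ht
    exact mul_nonneg (gapSum_nonneg ht) (peakDensity_nonneg a N t)
  have hKκ : K * κ ≤ 1 / 2 := by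
    have h1 : K * κ ≤ K * (d * 1024) / (N : ℝ) ^ 2 := by
      rw [mul_div_assoc]
      exact mul_le_mul_of_nonneg_left hκ1 hK0
    refine h1.trans ?_
    rw [div_le_iff₀ (by positivity)]
    nlinarith
  have hhalf : I / 2 ≤ ∫ t in cornerSimplex ι, peakDensity a N t := by
    refine le_trans ?_ hlow
    have := mul_le_mul_of_nonneg_left hH hK0
    nlinarith
  refine ⟨lt_of_lt_of_le (by positivity) hhalf, hup.trans (hH.trans ?_)⟩
  have h1 : κ * I ≤ d * 1024 / (N : ℝ) ^ 2 * I := mul_le_mul_of_nonneg_right hκ1 hI.le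
  refine h1.trans ?_
  have h2 : 2 * (d * 1024) / (N : ℝ) ^ 2 * (I / 2) ≤ 2 * (d * 1024) / (N : ℝ) ^ 2 *
    ∫ t in cornerSimplex ι, peakDensity a N t := by gcongr
  refine le_trans (le_of_eq ?_) h2
  ring

end Cube

lemma totalDegree_polynomial_aeval_le {σ : Type*} (A : MvPolynomial σ ℝ) (p : Polynomial ℝ) :
    (Polynomial.aeval A p).totalDegree ≤ p.natDegree * A.totalDegree := by
  rw [Polynomial.aeval_eq_sum_range]
  refine MvPolynomial.totalDegree_finsetSum_le fun i hi => ?_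
  refine (MvPolynomial.totalDegree_smul_le _ _).trans ((MvPolynomial.totalDegree_pow _ _).trans ?_)
  exact Nat.mul_le_mul_right _ (Nat.lt_succ_iff.1 (Finset.mem_range.1 hi))

lemma MvPolynomial.eval_polynomial_aeval {σ : Type*} (x : σ → ℝ) (A : MvPolynomial σ ℝ)
    (p : Polynomial ℝ) :
    MvPolynomial.eval x (Polynomial.aeval A p) = p.eval (MvPolynomial.eval x A) := by
  simp [Polynomial.aeval_eq_sum_range, Polynomial.eval_eq_sum_range, MvPolynomial.smul_eval]

lemma exists_mvPolynomial_eval_eq_affineMap {n : ℕ} (g : EuclideanSpace ℝ (Fin n) →ᵃ[ℝ] ℝ) :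
    ∃ A : MvPolynomial (Fin n) ℝ, A.totalDegree ≤ 1 ∧
      ∀ x : EuclideanSpace ℝ (Fin n), MvPolynomial.eval (fun i => x i) A = g x := by
  refine ⟨MvPolynomial.C (g 0) + ∑ k, MvPolynomial.C (g.linear (EuclideanSpace.single k 1)) *
    MvPolynomial.X k, ?_, fun x => ?_⟩
  · refine (MvPolynomial.totalDegree_add _ _).trans (max_le (by simp) ?_)
    refine MvPolynomial.totalDegree_finsetSum_le fun k _ => ?_
    refine (MvPolynomial.totalDegree_mul _ _).trans ?_
    simp
  · have hx : x = ∑ k, x k • EuclideanSpace.single k (1 : ℝ) := by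
      conv_lhs => rw [← (EuclideanSpace.basisFun (Fin n) ℝ).sum_repr x]
      simp
    have hg : g x = g.linear x + g 0 := by
      simpa using g.map_vadd 0 x
    rw [hg]
    conv_rhs => rw [hx]
    simp only [map_add, map_sum, map_mul, MvPolynomial.eval_C, MvPolynomial.eval_X, map_smul,
      smul_eq_mul]
    rw [add_comm]
    congr 1
    exact Finset.sum_congr rfl fun k _ => mul_comm _ _

lemma exists_first_order_bound {n : ℕ} (f : MvPolynomial (Fin n) ℝ)
    (a : EuclideanSpace ℝ (Fin n)) (R : ℝ) :
    ∃ (L : EuclideanSpace ℝ (Fin n) →L[ℝ] ℝ) (C : ℝ), 0 ≤ C ∧ ∀ x, ‖x - a‖ ≤ R →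
      |MvPolynomial.eval (fun i => x i) f - MvPolynomial.eval (fun i => a i) f - L (x - a)| ≤
        C * ‖x - a‖ ^ 2 := by
  induction f using MvPolynomial.induction_on with
  | C c => exact ⟨0, 0, le_rfl, fun x _ => by simp⟩
  | add p q hp hq =>
    obtain ⟨L, C, hC, h⟩ := hp
    obtain ⟨L', C', hC', h'⟩ := hq
    refine ⟨L + L', C + C', by positivity, fun x hx => ?_⟩
    have h1 := abs_le.1 (h x hx)
    have h2 := abs_le.1 (h' x hx)
    simp only [map_add, add_apply]
    rw [abs_le]
    constructor <;> linarith
  | mul_X p i hp =>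
    obtain ⟨L, C, hC, h⟩ := hp
    refine ⟨a i • L + MvPolynomial.eval (fun i => a i) p • EuclideanSpace.proj i,
      |a i| * C + (‖L‖ + C * |R|), by positivity, fun x hx => ?_⟩
    have h1 := h x hx
    set P := MvPolynomial.eval (fun i => x i) p
    set Q := MvPolynomial.eval (fun i => a i) p
    have hd : |x i - a i| ≤ ‖x - a‖ := by
      simpa using PiLp.norm_apply_le (x - a) i
    have hL : |L (x - a)| ≤ ‖L‖ * ‖x - a‖ := L.le_opNorm _
    have hd0 := norm_nonneg (x - a)
    have hPQ : |P - Q| ≤ (‖L‖ + C * |R|) * ‖x - a‖ := by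
      have h2 : |P - Q| ≤ |P - Q - L (x - a)| + |L (x - a)| := by
        simpa using abs_add_le (P - Q - L (x - a)) (L (x - a))
      have h3 : C * ‖x - a‖ ^ 2 ≤ C * (|R| * ‖x - a‖) := by
        rw [sq]
        have := hx.trans (le_abs_self R)
        gcongr
      linarith
    have key : MvPolynomial.eval (fun i => x i) (p * MvPolynomial.X i) -
        MvPolynomial.eval (fun i => a i) (p * MvPolynomial.X i) -
        (a i • L + Q • EuclideanSpace.proj (𝕜 := ℝ) i :
          EuclideanSpace ℝ (Fin n) →L[ℝ] ℝ) (x - a) =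
        a i * (P - Q - L (x - a)) + (x i - a i) * (P - Q) := by
      simp [P, Q]
      ring
    rw [key]
    refine (abs_add_le _ _).trans ?_
    rw [abs_mul, abs_mul]
    have h4 : |a i| * |P - Q - L (x - a)| ≤ |a i| * (C * ‖x - a‖ ^ 2) := by gcongr
    have h5 : |x i - a i| * |P - Q| ≤ ‖x - a‖ * ((‖L‖ + C * |R|) * ‖x - a‖) := by gcongr
    linarith

lemma lasserreError_le_of_sq {n r : ℕ} {K : Set (EuclideanSpace ℝ (Fin n))} (hK : IsCompact K)
    {F : EuclideanSpace ℝ (Fin n) → ℝ} (hF : Continuous F) {x₀ : EuclideanSpace ℝ (Fin n)}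
    (hx₀ : x₀ ∈ K) (hmin : ∀ x ∈ K, F x₀ ≤ F x) {p : MvPolynomial (Fin n) ℝ}
    (hp : p.totalDegree ≤ r) (hpos : 0 < ∫ x in K, MvPolynomial.eval (fun i => x i) p ^ 2) {κ : ℝ}
    (hκ : ∫ x in K, (F x - F x₀) * MvPolynomial.eval (fun i => x i) p ^ 2 ≤
      κ * ∫ x in K, MvPolynomial.eval (fun i => x i) p ^ 2) :
    lasserreError r K (fun _ => 1) F ≤ κ := by
  have hev : ∀ q : MvPolynomial (Fin n) ℝ,
      Continuous fun x : EuclideanSpace ℝ (Fin n) => MvPolynomial.eval (fun i => x i) q :=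
    fun q => (MvPolynomial.continuous_eval q).comp (by fun_prop)
  have hint : ∀ g : EuclideanSpace ℝ (Fin n) → ℝ, Continuous g → IntegrableOn g K := fun g hg =>
    hg.continuousOn.integrableOn_compact hK
  have hinf : sInf (F '' K) = F x₀ :=
    IsLeast.csInf_eq ⟨⟨x₀, hx₀, rfl⟩, by rintro _ ⟨x, hx, rfl⟩; exact hmin x hx⟩
  set J := ∫ x in K, MvPolynomial.eval (fun i => x i) p ^ 2 with hJ
  have hps := (hev p).pow 2
  have hle : lasserre r K (fun _ => 1) F ≤
      J⁻¹ * ∫ x in K, F x * MvPolynomial.eval (fun i => x i) p ^ 2 := by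
    refine csInf_le ⟨F x₀, ?_⟩ ⟨(MvPolynomial.C √J⁻¹ * p) ^ 2, ⟨1, fun _ => MvPolynomial.C √J⁻¹ * p,
      by simp⟩, ?_, ?_, ?_⟩
    · rintro v ⟨q, ⟨m, s, rfl⟩, -, h1, rfl⟩
      simp only [mul_one] at h1 ⊢
      have hq := hev (∑ i, s i ^ 2)
      calc F x₀ = ∫ x in K, F x₀ * MvPolynomial.eval (fun i => x i) (∑ i, s i ^ 2) := by
            rw [integral_const_mul, h1, mul_one]
        _ ≤ _ := by
            refine setIntegral_mono_on (hint _ (by fun_prop)) (hint _ (by fun_prop))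
              hK.measurableSet fun x hx => ?_
            refine mul_le_mul_of_nonneg_right (hmin x hx) ?_
            simp only [map_sum, map_pow]
            positivity
    · refine (MvPolynomial.totalDegree_pow _ _).trans (Nat.mul_le_mul_left 2 ?_)
      refine (MvPolynomial.totalDegree_mul _ _).trans ?_
      simpa using hp
    · simp only [map_pow, map_mul, MvPolynomial.eval_C, mul_pow, mul_one,
        Real.sq_sqrt (inv_nonneg.2 hpos.le)]
      rw [integral_const_mul]
      exact inv_mul_cancel₀ hpos.ne'
    · simp only [map_pow, map_mul, MvPolynomial.eval_C, mul_pow, mul_one,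
        Real.sq_sqrt (inv_nonneg.2 hpos.le)]
      rw [← integral_const_mul]
      congr 1
      ext x
      ring
  have hsub : ∫ x in K, (F x - F x₀) * MvPolynomial.eval (fun i => x i) p ^ 2 =
      (∫ x in K, F x * MvPolynomial.eval (fun i => x i) p ^ 2) - F x₀ * J := by
    simp only [sub_mul]
    rw [integral_sub (hint _ (by fun_prop)) (hint _ (by fun_prop)), integral_const_mul]
  have h1 : J⁻¹ * ∫ x in K, F x * MvPolynomial.eval (fun i => x i) p ^ 2 ≤ κ + F x₀ := by
    rw [inv_mul_le_iff₀ hpos]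
    linarith
  rw [lasserreError, hinf]
  linarith

lemma coord_add_smul_sub {ι E : Type*} [DecidableEq ι] [NormedAddCommGroup E]
    [NormedSpace ℝ E] (b : AffineBasis ι ℝ E) (i j k : ι) (x : E) (s : ℝ) :
    b.coord k (x + s • (b i - b j)) =
      b.coord k x + s * ((if k = i then 1 else 0) - if k = j then 1 else 0) := by
  have h1 := (b.coord k).map_vadd x (s • (b i - b j))
  have h2 := (b.coord k).linearMap_vsub (b i) (b j)
  simp only [vadd_eq_add, vsub_eq_sub] at h1 h2
  rw [add_comm, h1, map_smul, h2, b.coord_apply, b.coord_apply, smul_eq_mul, add_comm]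

/-- At a minimizer with positive `j`-th barycentric coordinate, the directional derivatives along
the edges leaving vertex `j` are nonnegative. -/
lemma map_sub_nonneg_of_isMinOn {ι E : Type*} [NormedAddCommGroup E] [NormedSpace ℝ E]
    (b : AffineBasis ι ℝ E) {F : E → ℝ} {x₀ : E}
    (hx₀ : x₀ ∈ convexHull ℝ (Set.range b)) (hmin : ∀ x ∈ convexHull ℝ (Set.range b), F x₀ ≤ F x)
    {L : E →L[ℝ] ℝ} {C : ℝ} (hC : 0 ≤ C)
    (hL : ∀ x ∈ convexHull ℝ (Set.range b), F x - F x₀ - L (x - x₀) ≤ C * ‖x - x₀‖ ^ 2)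
    {i j : ι} (hj : 0 < b.coord j x₀) : 0 ≤ L (b i - b j) := by
  classical
  by_contra! hneg
  set w := b i - b j
  set l := -L w with hl
  have hlpos : 0 < l := by linarith
  set D := C * ‖w‖ ^ 2 + 1 with hD
  have hDpos : 0 < D := by positivity
  set s := min (b.coord j x₀) (l / (2 * D)) with hs
  have hspos : 0 < s := lt_min hj (by positivity)
  have hmem : x₀ + s • w ∈ convexHull ℝ (Set.range b) := by
    rw [b.convexHull_eq_nonneg_coord] at hx₀ ⊢
    intro k
    rw [coord_add_smul_sub]
    have h1 := hx₀ k
    have h2 : s ≤ b.coord j x₀ := min_le_left _ _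
    split_ifs with h3 h4 h4
    · simpa using h1
    · simp only [sub_zero, mul_one]; positivity
    · subst h4; linarith
    · simpa using h1
  have h1 := hL _ hmem
  have h2 := hmin _ hmem
  have h3 : s * (2 * D) ≤ l := by
    rw [← le_div_iff₀ (by positivity)]; exact min_le_right _ _
  rw [add_sub_cancel_left, map_smul, norm_smul, mul_pow, Real.norm_eq_abs, sq_abs,
    smul_eq_mul] at h1
  have h4 : s * l ≤ s * (s * (C * ‖w‖ ^ 2)) := by nlinarith
  have h5 := le_of_mul_le_mul_left h4 hspos
  nlinarith

section Simplex

variable {ι E : Type*} [Fintype ι] [NormedAddCommGroup E] [NormedSpace ℝ E]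

/-- The barycentric coordinates of a point, except for the one with index `j`. -/
def cornerCoords (b : AffineBasis ι ℝ E) (j : ι) (x : E) : {i // i ≠ j} → ℝ := fun i => b.coord i x

variable [DecidableEq ι]

lemma cornerCoords_eq_equivFun (b : AffineBasis ι ℝ E) (j : ι) (x : E) :
    cornerCoords b j x = (b.basisOf j).equivFun (x - b j) := by
  have h1 : x - b j = ∑ i : {i // i ≠ j}, cornerCoords b j x i • b.basisOf j i := by
    have h2 : x - b j = ∑ i, b.coord i x • (b i - b j) := by
      simp_rw [smul_sub]
      rw [Finset.sum_sub_distrib, ← Finset.sum_smul, b.sum_coord_apply_eq_one, one_smul,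
        b.linear_combination_coord_eq_self]
    rw [h2, Fintype.sum_eq_add_sum_subtype_ne _ j]
    simp [cornerCoords, AffineBasis.basisOf_apply]
  rw [h1, ← Module.Basis.equivFun_symm_apply, LinearEquiv.apply_symm_apply]

lemma sub_eq_sum_cornerCoords (b : AffineBasis ι ℝ E) (j : ι) (x y : E) :
    x - y = ∑ i : {i // i ≠ j}, (cornerCoords b j x i - cornerCoords b j y i) • (b i - b j) := by
  have h : x - y = (b.basisOf j).equivFun.symm (cornerCoords b j x - cornerCoords b j y) := by
    rw [cornerCoords_eq_equivFun, cornerCoords_eq_equivFun, ← map_sub,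
      LinearEquiv.symm_apply_apply]
    abel
  conv_lhs => rw [h, Module.Basis.equivFun_symm_apply]
  simp [AffineBasis.basisOf_apply]

lemma sum_cornerCoords (b : AffineBasis ι ℝ E) (j : ι) (x : E) :
    ∑ i, cornerCoords b j x i = 1 - b.coord j x := by
  have := b.sum_coord_apply_eq_one x
  rw [Fintype.sum_eq_add_sum_subtype_ne _ j] at this
  simp only [cornerCoords]
  linarith

lemma convexHull_eq_preimage_cornerSimplex (b : AffineBasis ι ℝ E) (j : ι) :
    convexHull ℝ (Set.range b) = cornerCoords b j ⁻¹' cornerSimplex {i // i ≠ j} := by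
  rw [b.convexHull_eq_nonneg_coord]
  ext x
  simp only [Set.mem_ofPred_eq, Set.mem_preimage, cornerSimplex, sum_cornerCoords]
  constructor
  · exact fun h => ⟨fun i => h i, by linarith [h j]⟩
  · rintro ⟨h1, h2⟩ i
    by_cases hi : i = j
    · subst hi; linarith
    · exact h1 ⟨i, hi⟩

lemma exists_setIntegral_convexHull_eq [FiniteDimensional ℝ E] [MeasurableSpace E] [BorelSpace E]
    (μ : Measure E) [μ.IsAddHaarMeasure] (b : AffineBasis ι ℝ E) (j : ι) :
    ∃ κ : ℝ, 0 < κ ∧ ∀ g : ({i // i ≠ j} → ℝ) → ℝ,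
      ∫ x in convexHull ℝ (Set.range b), g (cornerCoords b j x) ∂μ =
        κ * ∫ t in cornerSimplex {i // i ≠ j}, g t := by
  let e : E ≃L[ℝ] ({i // i ≠ j} → ℝ) := (b.basisOf j).equivFun.toContinuousLinearEquiv
  let Ψ : E ≃ₜ ({i // i ≠ j} → ℝ) := (Homeomorph.addRight (-(b j))).trans e.toHomeomorph
  have hΨ : ⇑Ψ = cornerCoords b j := by
    ext1 x
    rw [cornerCoords_eq_equivFun]
    simp [Ψ, e, sub_eq_add_neg]
  have hmap : μ.map Ψ = μ.map e := by
    have : (⇑Ψ : E → _) = e ∘ fun x => x + -(b j) := rfl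
    rw [this, ← Measure.map_map e.continuous.measurable (measurable_add_const _),
      map_add_right_eq_self]
  have hhaar : (μ.map e).IsAddHaarMeasure := e.isAddHaarMeasure_map μ
  refine ⟨(μ.map e).addHaarScalarFactor volume,
    Measure.addHaarScalarFactor_pos_of_isAddHaarMeasure _ _, fun g => ?_⟩
  rw [convexHull_eq_preimage_cornerSimplex b j, ← hΨ,
    ← Ψ.isClosedEmbedding.measurableEmbedding.setIntegral_map, hmap]
  conv_lhs => rw [Measure.isAddLeftInvariant_eq_smul (μ.map e) volume]
  rw [Measure.restrict_smul, integral_smul_nnreal_measure]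
  rfl

lemma exists_sub_le_mul_gapSum (b : AffineBasis ι ℝ E) {F : E → ℝ} {x₀ : E}
    (hx₀ : x₀ ∈ convexHull ℝ (Set.range b)) (hmin : ∀ x ∈ convexHull ℝ (Set.range b), F x₀ ≤ F x)
    {L : E →L[ℝ] ℝ} {C : ℝ} (hC : 0 ≤ C)
    (hL : ∀ x ∈ convexHull ℝ (Set.range b), F x - F x₀ - L (x - x₀) ≤ C * ‖x - x₀‖ ^ 2)
    {j : ι} (hj : 0 < b.coord j x₀) :
    ∃ C' : ℝ, 0 ≤ C' ∧ ∀ x ∈ convexHull ℝ (Set.range b),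
      F x - F x₀ ≤ C' * gapSum (cornerCoords b j x₀) (cornerCoords b j x) := by
  set a := cornerCoords b j x₀ with ha
  set l : ℝ := ∑ i : {i // i ≠ j}, |L (b i - b j)| with hl
  set W : ℝ := ∑ i : {i // i ≠ j}, ‖b i - b j‖ ^ 2 with hW
  have hl0 : 0 ≤ l := Finset.sum_nonneg fun _ _ => abs_nonneg _
  have hW0 : 0 ≤ W := Finset.sum_nonneg fun _ _ => sq_nonneg _
  have ha0 : ∀ i, 0 ≤ a i := fun i => by
    rw [b.convexHull_eq_nonneg_coord] at hx₀
    exact hx₀ i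
  refine ⟨l + C * W, by positivity, fun x hx => ?_⟩
  have hcube : cornerCoords b j x ∈ unitCube {i // i ≠ j} := by
    rw [convexHull_eq_preimage_cornerSimplex b j] at hx
    exact cornerSimplex_subset_unitCube hx
  set t := cornerCoords b j x with ht
  have hgap : ∀ i, (t i - a i) ^ 2 ≤ (gapPoly (a i)).eval (t i) := fun i =>
    sq_sub_le_eval_gapPoly (hcube i trivial)
  have hgap0 : ∀ i, 0 ≤ (gapPoly (a i)).eval (t i) := fun i => (sq_nonneg _).trans (hgap i)
  have hsub := sub_eq_sum_cornerCoords b j x x₀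
  have hlin : L (x - x₀) ≤ l * gapSum a t := by
    rw [hsub, map_sum, gapSum, Finset.mul_sum]
    refine Finset.sum_le_sum fun i _ => ?_
    rw [map_smul, smul_eq_mul]
    have hli : |L (b i - b j)| ≤ l :=
      Finset.single_le_sum (f := fun i : {i // i ≠ j} => |L (b i - b j)|)
        (fun _ _ => abs_nonneg _) (Finset.mem_univ i)
    rcases (ha0 i).eq_or_lt with h0 | h0
    · rw [eval_gapPoly, if_pos h0.symm]
      have h1 : 0 ≤ t i := (hcube i trivial).1
      have h2 := (le_abs_self _).trans hli
      change (t i - a i) * _ ≤ _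
      rw [← h0, sub_zero]
      nlinarith
    · have h1 := map_sub_nonneg_of_isMinOn b hx₀ hmin hC hL (i := i) hj
      have h2 := map_sub_nonneg_of_isMinOn b hx₀ hmin hC hL (i := j) h0
      have h3 : L (b i - b j) = 0 := by
        rw [← neg_sub, map_neg] at h2
        linarith
      rw [h3, mul_zero]
      exact mul_nonneg hl0 (hgap0 i)
  have hquad : ‖x - x₀‖ ^ 2 ≤ W * gapSum a t := by
    have h1 : ‖x - x₀‖ ≤ ∑ i : {i // i ≠ j}, |t i - a i| * ‖b i - b j‖ := by
      rw [hsub]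
      refine (norm_sum_le _ _).trans (le_of_eq ?_)
      simp [norm_smul, t, a]
    have h2 := Finset.sum_mul_sq_le_sq_mul_sq Finset.univ (fun i => |t i - a i|)
      (fun i : {i // i ≠ j} => ‖b i - b j‖)
    have h3 : ∑ i, |t i - a i| ^ 2 ≤ gapSum a t :=
      Finset.sum_le_sum fun i _ => by rw [sq_abs]; exact hgap i
    calc ‖x - x₀‖ ^ 2 ≤ (∑ i : {i // i ≠ j}, |t i - a i| * ‖b i - b j‖) ^ 2 := by gcongr
      _ ≤ _ := h2
      _ ≤ gapSum a t * W := by gcongr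
      _ = W * gapSum a t := mul_comm _ _
  have h1 := hL x hx
  have h2 := mul_le_mul_of_nonneg_left hquad hC
  linarith

end Simplex

lemma exists_totalDegree_le_eval_sq_eq_peakDensity {n : ℕ}
    (b : AffineBasis (Fin (n + 1)) ℝ (EuclideanSpace ℝ (Fin n))) (j : Fin (n + 1))
    (a : {i // i ≠ j} → ℝ) (N : ℕ) :
    ∃ p : MvPolynomial (Fin n) ℝ, p.totalDegree ≤ n * (6 * N) ∧
      ∀ x : EuclideanSpace ℝ (Fin n), MvPolynomial.eval (fun i => x i) p ^ 2 =
        peakDensity a N (cornerCoords b j x) := by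
  choose A hA hAe using fun i => exists_mvPolynomial_eval_eq_affineMap (b.coord i)
  refine ⟨∏ i : {i // i ≠ j}, Polynomial.aeval (A i) (peakPoly (a i) N), ?_, fun x => ?_⟩
  · refine (MvPolynomial.totalDegree_finsetProd _ _).trans ?_
    refine (Finset.sum_le_card_nsmul _ _ (6 * N) fun i _ => ?_).trans ?_
    · refine (totalDegree_polynomial_aeval_le _ _).trans ?_
      exact (Nat.mul_le_mul (natDegree_peakPoly_le _ _) (hA i)).trans (by simp)
    · simp
  · simp only [map_prod, MvPolynomial.eval_polynomial_aeval, hAe, peakDensity, cornerCoords,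
      Finset.prod_pow]

/-- An eventual `O(1 / N ^ 2)` bound along degrees `k * N`, together with boundedness, gives an
`O(1 / r ^ 2)` bound for all `r ≥ 1`. -/
lemma exists_le_div_sq {E : ℕ → ℝ} {B c : ℝ} {k M : ℕ} (hk : 0 < k) (hc : 0 ≤ c)
    (hB : ∀ r, E r ≤ B) (hE : ∀ N r, M ≤ N → k * N ≤ r → E r ≤ c / (N : ℝ) ^ 2) :
    ∃ c' : ℝ, 0 < c' ∧ ∀ r : ℕ, 1 ≤ r → E r ≤ c' / (r : ℝ) ^ 2 := by
  refine ⟨c * (2 * k) ^ 2 + |B| * (k * (M + 1)) ^ 2 + 1, by positivity, fun r hr => ?_⟩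
  have hr0 : (0 : ℝ) < r := by exact_mod_cast hr
  rw [le_div_iff₀ (by positivity)]
  by_cases hN : M + 1 ≤ r / k
  · set N := r / k with hNdef
    have hN1 : (1 : ℝ) ≤ N := by exact_mod_cast (by omega : 1 ≤ N)
    have h1 := hE N r (by omega) (Nat.mul_div_le r k)
    have h2 : (r : ℝ) ≤ k * (N + 1) := by
      exact_mod_cast (Nat.lt_mul_div_succ r hk).le
    have h3 : (r : ℝ) ≤ 2 * k * N := by
      have : (0 : ℝ) < k := by exact_mod_cast hk
      nlinarith
    have h4 : c / (N : ℝ) ^ 2 * (r : ℝ) ^ 2 ≤ c / (N : ℝ) ^ 2 * (2 * k * N) ^ 2 := by gcongr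
    have h5 : c / (N : ℝ) ^ 2 * (2 * k * N) ^ 2 = c * (2 * k) ^ 2 := by field_simp
    have h6 : E r * (r : ℝ) ^ 2 ≤ c / (N : ℝ) ^ 2 * (r : ℝ) ^ 2 := by gcongr
    have h7 : 0 ≤ |B| * (k * (M + 1) : ℝ) ^ 2 := by positivity
    linarith
  · have h1 : (r : ℝ) ≤ k * (M + 1) := by
      have h2 : r < (M + 1) * k := (Nat.div_lt_iff_lt_mul hk).1 (not_le.1 hN)
      rw [mul_comm] at h2
      exact_mod_cast h2.le
    have h2 : E r * (r : ℝ) ^ 2 ≤ |B| * (r : ℝ) ^ 2 := by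
      gcongr
      exact (hB r).trans (le_abs_self B)
    have h3 : |B| * (r : ℝ) ^ 2 ≤ |B| * (k * (M + 1)) ^ 2 := by gcongr
    have h4 : 0 ≤ c * (2 * k : ℝ) ^ 2 := by positivity
    linarith

lemma exists_coord_pos {ι E : Type*} [Fintype ι] [NormedAddCommGroup E] [NormedSpace ℝ E]
    (b : AffineBasis ι ℝ E) (x : E) : ∃ j, 0 < b.coord j x := by
  by_contra! h
  have h1 := b.sum_coord_apply_eq_one x
  have h2 : ∑ i, b.coord i x ≤ 0 := Finset.sum_nonpos fun i _ => h i
  linarith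

/-- Theorem: for a full-dimensional simplex `Δ = conv{v₀, …, vₙ} ⊆ ℝⁿ` (convex hull of
`n+1` affinely independent points) equipped with the Lebesgue measure, the Lasserre
error of any polynomial `f` is `O(1/r²)`. -/
theorem stmt5 {n : ℕ}
    (v : Fin (n + 1) → EuclideanSpace ℝ (Fin n))
    (hv : AffineIndependent ℝ v)
    (Δ : Set (EuclideanSpace ℝ (Fin n)))
    (hΔ : Δ = convexHull ℝ (Set.range v))
    (f : MvPolynomial (Fin n) ℝ)
    (F : EuclideanSpace ℝ (Fin n) → ℝ)
    (hF : ∀ x : EuclideanSpace ℝ (Fin n), F x = MvPolynomial.eval (fun i => x i) f) :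
    ∃ c : ℝ, 0 < c ∧ ∀ r : ℕ, 1 ≤ r →
      lasserreError r Δ (fun _ => 1) F ≤ c / (r : ℝ) ^ 2 := by
  obtain ⟨b, rfl⟩ : ∃ b : AffineBasis (Fin (n + 1)) ℝ (EuclideanSpace ℝ (Fin n)), ⇑b = v :=
    ⟨⟨v, hv, hv.affineSpan_eq_top_iff_card_eq_finrank_add_one.2 (by simp)⟩, rfl⟩
  subst hΔ
  set Δ := convexHull ℝ (Set.range b) with hΔ
  have hΔc : IsCompact Δ := (Set.finite_range b).isCompact_convexHull (𝕜 := ℝ)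
  have hFc : Continuous F := by
    rw [funext hF]
    exact (MvPolynomial.continuous_eval f).comp (by fun_prop)
  obtain ⟨x₀, hx₀, hmin⟩ := hΔc.exists_isMinOn
    ((Set.range_nonempty b).mono (subset_convexHull ℝ (Set.range b))) hFc.continuousOn
  replace hmin : ∀ x ∈ Δ, F x₀ ≤ F x := hmin
  obtain ⟨j, hj⟩ := exists_coord_pos b x₀
  set a := cornerCoords b j x₀ with ha
  obtain ⟨L, C, hC, hL⟩ := exists_first_order_bound f x₀ (Metric.diam Δ)
  obtain ⟨C', hC', hgap⟩ := exists_sub_le_mul_gapSum b hx₀ hmin hC (L := L) (fun x hx => by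
    rw [hF, hF]
    refine (le_abs_self _).trans (hL x ?_)
    rw [← dist_eq_norm]
    exact Metric.dist_le_diam_of_mem hΔc.isBounded hx hx₀) hj
  obtain ⟨c, M, hc, hest⟩ := peakDensity_cornerSimplex_estimate (a := a)
    (fun i => by
      have h := hx₀
      rw [hΔ, b.convexHull_eq_nonneg_coord] at h
      exact h i)
    (by rw [ha, sum_cornerCoords]; linarith)
  obtain ⟨κ, hκ, htransfer⟩ := exists_setIntegral_convexHull_eq volume b j
  have hcoords : Continuous (cornerCoords b j) :=
    continuous_pi fun i => continuous_barycentric_coord b i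
  have hint : ∀ g : EuclideanSpace ℝ (Fin n) → ℝ, Continuous g → IntegrableOn g Δ := fun g hg =>
    hg.continuousOn.integrableOn_compact hΔc
  have hpos : ∀ N, M ≤ N → 0 < ∫ x in Δ, peakDensity a N (cornerCoords b j x) := fun N hN => by
    rw [htransfer]
    exact mul_pos hκ (hest N hN).1
  have hone : 0 < ∫ x in Δ, (1 : ℝ) := by
    refine (integral_nonneg fun _ => zero_le_one).lt_of_ne fun h => ?_
    have hvol : volume Δ = 0 := by
      have h1 : volume.real Δ = 0 := by simpa using h.symm
      exact (measureReal_eq_zero_iff hΔc.measure_lt_top.ne).1 h1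
    have := hpos M le_rfl
    rw [Measure.restrict_eq_zero.2 hvol] at this
    simp at this
  refine exists_le_div_sq (E := fun r => lasserreError r Δ (fun _ => 1) F)
    (B := (∫ x in Δ, (F x - F x₀)) / ∫ x in Δ, (1 : ℝ)) (c := C' * c) (k := 6 * (n + 1)) (M := M)
    (by positivity) (by positivity) (fun r => ?_) (fun N r hN hr => ?_)
  · refine lasserreError_le_of_sq hΔc hFc hx₀ hmin (p := 1) (by simp) (by simpa using hone) ?_
    simp only [map_one, one_pow, mul_one]
    exact (div_mul_cancel₀ _ hone.ne').ge
  · obtain ⟨p, hpdeg, hp⟩ := exists_totalDegree_le_eval_sq_eq_peakDensity b j a N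
    refine lasserreError_le_of_sq hΔc hFc hx₀ hmin (p := p) (hpdeg.trans (by nlinarith)) ?_ ?_
    · simp only [hp]
      exact hpos N hN
    · simp only [hp]
      have hd := (continuous_peakDensity a N).comp hcoords
      have hs := (continuous_gapSum a).comp hcoords
      simp only [Function.comp_def] at hd hs
      calc ∫ x in Δ, (F x - F x₀) * peakDensity a N (cornerCoords b j x)
          ≤ ∫ x in Δ, C' * (gapSum a (cornerCoords b j x) *
              peakDensity a N (cornerCoords b j x)) := by
            refine setIntegral_mono_on (hint _ (by fun_prop)) (hint _ (by fun_prop))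
              hΔc.measurableSet fun x hx => ?_
            rw [← mul_assoc]
            exact mul_le_mul_of_nonneg_right (hgap x hx) (peakDensity_nonneg _ _ _)
        _ ≤ C' * c / (N : ℝ) ^ 2 * ∫ x in Δ, peakDensity a N (cornerCoords b j x) := by
            rw [integral_const_mul, htransfer fun t => gapSum a t * peakDensity a N t,
              htransfer fun t => peakDensity a N t]
            have := mul_le_mul_of_nonneg_left (hest N hN).2 (mul_nonneg hC' hκ.le)
            calc _ ≤ _ := by simpa only [mul_assoc] using this
              _ = _ := by ring
end
end

section
/- Let K ⊆ ℝⁿ be a convex body (a compact convex set with nonempty interior), equipped with the Lebesgue measure (weight w ≡ 1), and let f be an n-variate real polynomial. Then there exists a constant c > 0 (depending only on K and f) such that for every integer r ≥ 2 one has E^{(r)}_K(f) ≤ c · (log r)^2 / r^2. -/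
open MeasureTheory

noncomputable section

/-- A Chebyshev polynomial composed with `t ↦ cosh y - t` decays on `[cosh y - 1, 1]`. -/
lemma mul_sq_eval_chebyshev_le (s : ℕ) (y : ℝ) {t : ℝ} (ht1 : t ≤ 1) :
    t * ((Polynomial.Chebyshev.T ℝ s).eval (Real.cosh y - t)) ^ 2 ≤
      (Real.cosh y - 1) * ((Polynomial.Chebyshev.T ℝ s).eval (Real.cosh y - t)) ^ 2 + 1 := by
  have hc := Real.one_le_cosh y
  rcases le_total t (Real.cosh y - 1) with h | h
  · nlinarith [mul_le_mul_of_nonneg_right h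
      (sq_nonneg ((Polynomial.Chebyshev.T ℝ s).eval (Real.cosh y - t)))]
  · have hle : |(Polynomial.Chebyshev.T ℝ s).eval (Real.cosh y - t)| ≤ 1 :=
      Polynomial.Chebyshev.abs_eval_T_real_le_one s (abs_le.2 ⟨by linarith, by linarith⟩)
    have hsq := (sq_le_one_iff_abs_le_one _).2 hle
    nlinarith [sq_nonneg ((Polynomial.Chebyshev.T ℝ s).eval (Real.cosh y - t))]

lemma Real.one_add_sq_half_le_cosh (x : ℝ) : 1 + x ^ 2 / 2 ≤ Real.cosh x := by
  wlog hx : 0 ≤ x generalizing x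
  · simpa using this (-x) (by linarith)
  have h1 : Real.cosh x = 1 + 2 * Real.sinh (x / 2) ^ 2 := by
    have h2 := Real.cosh_two_mul (x / 2)
    have h3 := Real.cosh_sq (x / 2)
    rw [show 2 * (x / 2) = x by ring] at h2
    linarith
  have h4 : x / 2 ≤ Real.sinh (x / 2) := Real.self_le_sinh_iff.2 (by linarith)
  nlinarith

lemma Real.cosh_sub_one_le {x B : ℝ} (hx : 0 ≤ x) (hxB : x ≤ B) :
    Real.cosh x - 1 ≤ x ^ 2 * Real.exp (B ^ 2) := by
  have h1 := Real.cosh_le_exp_half_sq x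
  have h2 : Real.exp (x ^ 2 / 2) - 1 ≤ x ^ 2 / 2 * Real.exp (x ^ 2 / 2) := by
    have h3 := Real.add_one_le_exp (-(x ^ 2 / 2))
    have h4 : Real.exp (-(x ^ 2 / 2)) * Real.exp (x ^ 2 / 2) = 1 := by
      rw [← Real.exp_add]; simp
    nlinarith [Real.exp_pos (x ^ 2 / 2)]
  have h5 : Real.exp (x ^ 2 / 2) ≤ Real.exp (B ^ 2) := Real.exp_le_exp.2 (by nlinarith)
  nlinarith [sq_nonneg x, Real.exp_pos (x ^ 2 / 2),
    mul_le_mul_of_nonneg_left h5 (sq_nonneg x), mul_nonneg (sq_nonneg x) (Real.exp_pos (x ^ 2 / 2)).le]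

/-- Near `0`, a Chebyshev polynomial composed with `t ↦ cosh y - t` is exponentially large. -/
lemma exp_div_four_le_sq_eval_chebyshev (s : ℕ) {y t : ℝ} (hy : 0 ≤ y)
    (ht : t ≤ 3 / 8 * y ^ 2) :
    Real.exp (s * y) / 4 ≤ ((Polynomial.Chebyshev.T ℝ s).eval (Real.cosh y - t)) ^ 2 := by
  have hw := Real.one_add_sq_half_le_cosh (y / 2)
  have hy2 : Real.cosh y = 2 * Real.cosh (y / 2) ^ 2 - 1 := by
    have h2 := Real.cosh_two_mul (y / 2)
    have h3 := Real.cosh_sq (y / 2)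
    rw [show 2 * (y / 2) = y by ring] at h2
    linarith
  have hge : Real.cosh (y / 2) ≤ Real.cosh y - t := by
    nlinarith [Real.one_le_cosh (y / 2)]
  have h1 : 1 ≤ Real.cosh y - t := (Real.one_le_cosh _).trans hge
  have hz := Real.cosh_arcosh h1
  have hz0 := Real.arcosh_nonneg h1
  set z := Real.arcosh (Real.cosh y - t)
  rw [← hz] at hge ⊢
  rw [Polynomial.Chebyshev.T_real_cosh]
  have hyz : y / 2 ≤ z := by
    have := Real.cosh_le_cosh.1 hge
    rwa [abs_of_nonneg (by linarith), abs_of_nonneg hz0] at this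
  have h2 : Real.exp (s * y / 2) / 2 ≤ Real.cosh (((s : ℤ) : ℝ) * z) := by
    rw [Real.cosh_eq]
    have h3 : Real.exp (s * y / 2) ≤ Real.exp (((s : ℤ) : ℝ) * z) := by
      apply Real.exp_le_exp.2
      push_cast
      nlinarith [mul_le_mul_of_nonneg_left hyz (Nat.cast_nonneg (α := ℝ) s)]
    have := Real.exp_pos (-(((s : ℤ) : ℝ) * z))
    linarith
  have h4 : Real.exp (s * y) / 4 = (Real.exp (s * y / 2) / 2) ^ 2 := by
    rw [div_pow, ← Real.exp_nat_mul]
    norm_num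
    ring
  rw [h4]
  exact pow_le_pow_left₀ (by positivity) h2 2

lemma MvPolynomial.totalDegree_aeval_le {σ : Type*} (P : Polynomial ℝ) (g : MvPolynomial σ ℝ) :
    (Polynomial.aeval g P).totalDegree ≤ P.natDegree * g.totalDegree := by
  rw [Polynomial.aeval_eq_sum_range]
  refine MvPolynomial.totalDegree_finsetSum_le fun i hi => ?_
  refine (MvPolynomial.totalDegree_smul_le _ _).trans ((MvPolynomial.totalDegree_pow _ _).trans ?_)
  exact Nat.mul_le_mul_right _ (Nat.lt_succ_iff.1 (Finset.mem_range.1 hi))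

lemma contDiff_eval_mvPolynomial {n : ℕ} (p : MvPolynomial (Fin n) ℝ) :
    ContDiff ℝ 1 (fun x : EuclideanSpace ℝ (Fin n) => MvPolynomial.eval (fun i => x i) p) := by
  induction p using MvPolynomial.induction_on with
  | C a => simpa using contDiff_const
  | add p q hp hq => simpa using hp.add hq
  | mul_X p i hp =>
    simp only [map_mul, MvPolynomial.eval_X]
    exact hp.mul (by fun_prop)

/-- A square `p ^ 2` of a polynomial of degree at most `r` for which `(F - min F) * p ^ 2` is
suitably bounded on `K` bounds the Lasserre error. -/
lemma lasserreError_le {n : ℕ} {K : Set (EuclideanSpace ℝ (Fin n))} (hKc : IsCompact K)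
    {F : EuclideanSpace ℝ (Fin n) → ℝ} (hF : Continuous F)
    {a : EuclideanSpace ℝ (Fin n)} (ha : a ∈ K) (hmin : ∀ x ∈ K, F a ≤ F x)
    {r : ℕ} {p : MvPolynomial (Fin n) ℝ} (hp : p.totalDegree ≤ r) {α β : ℝ}
    (hpos : 0 < ∫ x in K, (MvPolynomial.eval (fun i => x i) p) ^ 2)
    (hle : ∀ x ∈ K, (F x - F a) * (MvPolynomial.eval (fun i => x i) p) ^ 2 ≤
      α * (MvPolynomial.eval (fun i => x i) p) ^ 2 + β) :
    lasserreError r K (fun _ => 1) F ≤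
      α + β * volume.real K / ∫ x in K, (MvPolynomial.eval (fun i => x i) p) ^ 2 := by
  have hcont (q : MvPolynomial (Fin n) ℝ) : Continuous
      (fun x : EuclideanSpace ℝ (Fin n) => MvPolynomial.eval (fun i => x i) q) :=
    (contDiff_eval_mvPolynomial q).continuous
  have hint {g : EuclideanSpace ℝ (Fin n) → ℝ} (hg : Continuous g) : IntegrableOn g K :=
    hg.continuousOn.integrableOn_compact hKc
  have hinf : sInf (F '' K) = F a := by
    refine IsLeast.csInf_eq ⟨⟨a, ha, rfl⟩, ?_⟩
    rintro _ ⟨x, hx, rfl⟩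
    exact hmin x hx
  set I := ∫ x in K, (MvPolynomial.eval (fun i => x i) p) ^ 2 with hI
  have hsub (q : MvPolynomial (Fin n) ℝ) :
      ∫ x in K, (F x - F a) * MvPolynomial.eval (fun i => x i) q =
        (∫ x in K, F x * MvPolynomial.eval (fun i => x i) q) -
          F a * ∫ x in K, MvPolynomial.eval (fun i => x i) q := by
    have hq := hcont q
    rw [← integral_const_mul, ← integral_sub (hint (by fun_prop)) (hint (by fun_prop))]
    simp only [sub_mul]
  have hbdd : ∫ x in K, (F x - F a) * MvPolynomial.eval (fun i => x i) (p ^ 2) ≤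
      α * I + β * volume.real K := by
    have hsq := hcont (p ^ 2)
    calc _ ≤ ∫ x in K, (α * MvPolynomial.eval (fun i => x i) (p ^ 2) + β) := by
          refine setIntegral_mono_on (hint (by fun_prop)) (hint (by fun_prop))
            hKc.measurableSet fun x hx => ?_
          simpa using hle x hx
      _ = _ := by
          rw [integral_add (hint (by fun_prop)) (hint (by fun_prop)), integral_const_mul,
            setIntegral_const]
          simp [hI, mul_comm]
  rw [lasserreError, hinf, lasserre, sub_le_iff_le_add]
  have hval : (∫ x in K, F x * MvPolynomial.eval (fun i => x i) (MvPolynomial.C (1 / I) * p ^ 2)) ≤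
      α + β * volume.real K / I + F a := by
    have h1 := hsub (p ^ 2)
    have h2 : ∫ x in K, MvPolynomial.eval (fun i => x i) (p ^ 2) = I := by simp [hI]
    have h3 : (∫ x in K, F x * MvPolynomial.eval (fun i => x i)
        (MvPolynomial.C (1 / I) * p ^ 2)) =
        1 / I * ∫ x in K, F x * MvPolynomial.eval (fun i => x i) (p ^ 2) := by
      rw [← integral_const_mul]
      refine integral_congr_ae (ae_of_all _ fun x => ?_)
      simp only [map_mul, MvPolynomial.eval_C]
      ring
    rw [h3]
    rw [h2] at h1
    rw [one_div, inv_mul_le_iff₀ hpos]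
    have h4 : I * (α + β * volume.real K / I + F a) = α * I + β * volume.real K + F a * I := by
      field_simp
    linarith
  refine le_trans (csInf_le ⟨F a, ?_⟩ ⟨MvPolynomial.C (1 / I) * p ^ 2, ?_, ?_, ?_, rfl⟩) ?_
  · rintro _ ⟨q, ⟨m, u, rfl⟩, -, hq1, rfl⟩
    simp only [mul_one] at hq1 ⊢
    have h1 := hsub (∑ i, u i ^ 2)
    have h2 : 0 ≤ ∫ x in K, (F x - F a) * MvPolynomial.eval (fun i => x i) (∑ i, u i ^ 2) := by
      refine setIntegral_nonneg hKc.measurableSet fun x hx => ?_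
      refine mul_nonneg (sub_nonneg.2 (hmin x hx)) ?_
      simp only [map_sum, map_pow]
      exact Finset.sum_nonneg fun i _ => sq_nonneg _
    rw [hq1] at h1
    linarith
  · refine ⟨1, fun _ => MvPolynomial.C (Real.sqrt (1 / I)) * p, ?_⟩
    simp only [Finset.univ_unique, Finset.sum_const, Finset.card_singleton, one_smul]
    rw [mul_pow, ← map_pow, Real.sq_sqrt (by positivity)]
  · refine (MvPolynomial.totalDegree_mul _ _).trans ?_
    have := MvPolynomial.totalDegree_pow p 2
    simp only [MvPolynomial.totalDegree_C]
    omega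
  · simp only [mul_one, map_mul, map_pow, MvPolynomial.eval_C]
    rw [integral_const_mul, ← hI]
    field_simp
  · simpa using hval

/-- Shrinking a convex set towards one of its points `a` bounds the integral over the whole set of
a nonnegative function which is large near `a`. -/
lemma pow_mul_le_setIntegral {n : ℕ} {K : Set (EuclideanSpace ℝ (Fin n))} (hKc : IsCompact K)
    (hKconv : Convex ℝ K) {a : EuclideanSpace ℝ (Fin n)} (ha : a ∈ K)
    {g : EuclideanSpace ℝ (Fin n) → ℝ} (hg : Continuous g) (hg0 : ∀ x, 0 ≤ g x)
    {ε c : ℝ} (hε0 : 0 ≤ ε) (hε1 : ε ≤ 1)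
    (hc : ∀ x ∈ K, c ≤ g (AffineMap.homothety a ε x)) :
    c * (ε ^ n * volume.real K) ≤ ∫ x in K, g x := by
  have hsub : AffineMap.homothety a ε '' K ⊆ K := by
    rintro _ ⟨x, hx, rfl⟩
    rw [AffineMap.homothety_eq_lineMap]
    exact hKconv.lineMap_mem ha hx ⟨hε0, hε1⟩
  have hcomp : IsCompact (AffineMap.homothety a ε '' K) :=
    hKc.image (AffineMap.homothety_continuous a ε)
  have hvol : volume.real (AffineMap.homothety a ε '' K) = ε ^ n * volume.real K := by
    rw [measureReal_def, Measure.addHaar_image_homothety, ENNReal.toReal_mul,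
      ENNReal.toReal_ofReal (abs_nonneg _), finrank_euclideanSpace_fin,
      abs_of_nonneg (by positivity), measureReal_def]
  rw [← hvol]
  refine (setIntegral_ge_of_const_le_real hcomp.measurableSet hcomp.measure_ne_top ?_
    (hg.continuousOn.integrableOn_compact hcomp)).trans ?_
  · rintro _ ⟨x, hx, rfl⟩
    exact hc x hx
  · exact setIntegral_mono_set (hg.continuousOn.integrableOn_compact hKc)
      (ae_of_all _ hg0) hsub.eventuallyLE

lemma exists_sub_le_of_homothety {n : ℕ} {K : Set (EuclideanSpace ℝ (Fin n))} (hKc : IsCompact K)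
    (hKconv : Convex ℝ K) {a : EuclideanSpace ℝ (Fin n)} (ha : a ∈ K)
    {F : EuclideanSpace ℝ (Fin n) → ℝ} (hF : ContDiff ℝ 1 F) :
    ∃ L : ℝ, 0 ≤ L ∧ ∀ ε : ℝ, 0 ≤ ε → ε ≤ 1 → ∀ x ∈ K,
      F (AffineMap.homothety a ε x) - F a ≤ L * ε := by
  obtain ⟨C, hC⟩ :=
    hF.locallyLipschitz.locallyLipschitzOn.exists_lipschitzOnWith_of_compact (s := K) hKc
  refine ⟨C * Metric.diam K, by positivity, fun ε h0 h1 x hx => ?_⟩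
  have hmem : AffineMap.homothety a ε x ∈ K := by
    rw [AffineMap.homothety_eq_lineMap]
    exact hKconv.lineMap_mem ha hx ⟨h0, h1⟩
  have hd := hC.dist_le_mul _ hmem _ ha
  rw [dist_homothety_center, Real.norm_of_nonneg h0, Real.dist_eq] at hd
  have hdiam := Metric.dist_le_diam_of_mem hKc.isBounded ha hx
  calc _ ≤ _ := (le_abs_self _).trans hd
    _ ≤ C * (ε * Metric.diam K) := by gcongr
    _ = _ := by ring

/-- Theorem: for a convex body `K ⊆ ℝⁿ` (compact convex with nonempty interior)
equipped with the Lebesgue measure, the Lasserre error of any polynomial `f` is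
`O(log² r / r²)`. -/
theorem stmt7 {n : ℕ}
    (K : Set (EuclideanSpace ℝ (Fin n)))
    (hKc : IsCompact K) (hKconv : Convex ℝ K) (hKi : (interior K).Nonempty)
    (f : MvPolynomial (Fin n) ℝ)
    (F : EuclideanSpace ℝ (Fin n) → ℝ)
    (hF : ∀ x : EuclideanSpace ℝ (Fin n), F x = MvPolynomial.eval (fun i => x i) f) :
    ∃ c : ℝ, 0 < c ∧ ∀ r : ℕ, 2 ≤ r →
      lasserreError r K (fun _ => 1) F ≤ c * (Real.log r) ^ 2 / (r : ℝ) ^ 2 := by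
  have hFeq : F = fun x => MvPolynomial.eval (fun i => x i) f := funext hF
  have hFd : ContDiff ℝ 1 F := hFeq ▸ contDiff_eval_mvPolynomial f
  have hFc : Continuous F := hFd.continuous
  obtain ⟨a, ha, hmin⟩ := hKc.exists_isMinOn (hKi.mono interior_subset) hFc.continuousOn
  replace hmin : ∀ x ∈ K, F a ≤ F x := fun x hx => hmin hx
  obtain ⟨b, hb, hmax⟩ := hKc.exists_isMaxOn ⟨a, ha⟩ hFc.continuousOn
  replace hmax : ∀ x ∈ K, F x ≤ F b := fun x hx => hmax hx
  have hV : 0 < volume.real K :=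
    ENNReal.toReal_pos (Measure.measure_pos_of_nonempty_interior volume hKi).ne' hKc.measure_ne_top
  obtain ⟨L, hL0, hL⟩ := exists_sub_le_of_homothety hKc hKconv ha hFd
  set M : ℝ := F b - F a + 1 with hM
  have hM1 : 1 ≤ M := by linarith [hmin b hb]
  set D : ℕ := f.totalDegree + 1 with hD
  set B : ℝ := 4 * D * (n + 1) with hB
  have hB0 : 0 ≤ B := by positivity
  refine ⟨M * (B ^ 2 * Real.exp (B ^ 2) + 16 * (4 * (L + 1)) ^ n + 4 * D ^ 2), by positivity,
    fun r hr => ?_⟩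
  have hr2 : (2 : ℝ) ≤ r := by exact_mod_cast hr
  have hr0 : (0 : ℝ) < r := by linarith
  have hlog : 1 / 2 ≤ Real.log r := by
    have := Real.log_le_log (by norm_num) hr2
    linarith [Real.log_two_gt_d9]
  have hlogr : Real.log r ≤ r := Real.log_le_self hr0.le
  have hlog2 : 1 ≤ 4 * Real.log r ^ 2 := by nlinarith
  rcases lt_or_ge r D with hrD | hrD
  · have h := lasserreError_le (r := r) (p := 1) (α := M) (β := 0) hKc hFc ha hmin (by simp)
      (by simpa using hV) (fun x hx => by simpa using by linarith [hmax x hx])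
    have hrD' : (r : ℝ) ≤ D := by exact_mod_cast hrD.le
    have h1 : (r : ℝ) ^ 2 ≤ 4 * D ^ 2 * Real.log r ^ 2 := by nlinarith
    rw [zero_mul, zero_div, add_zero] at h
    refine h.trans ?_
    rw [le_div_iff₀ (by positivity), mul_assoc M]
    gcongr
    refine h1.trans ?_
    gcongr
    linarith [show 0 ≤ B ^ 2 * Real.exp (B ^ 2) + 16 * (4 * (L + 1)) ^ n by positivity]
  · set s : ℕ := r / D with hs
    have hs1 : 1 ≤ s := (Nat.one_le_div_iff (by omega)).2 hrD
    have hsD : s * D ≤ r := Nat.div_mul_le_self r D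
    have hsr : (s : ℝ) ≤ r := by exact_mod_cast Nat.div_le_self r D
    have hrs : (r : ℝ) ≤ 2 * D * s := by
      have h1 : r < D * (s + 1) := Nat.lt_mul_div_succ r (by omega)
      have h2 : r ≤ 2 * D * s := by nlinarith
      exact_mod_cast h2
    have hs0 : (0 : ℝ) < s := by exact_mod_cast hs1
    set y : ℝ := 2 * (n + 1) * Real.log r / s with hy
    have hy0 : 0 ≤ y := by positivity
    have hyB : y ≤ B * (Real.log r / r) := by
      rw [hy, hB, div_le_iff₀ hs0]
      have : (1 : ℝ) ≤ 2 * D * s / r := (one_le_div hr0).2 hrs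
      calc _ = 2 * (n + 1) * Real.log r * 1 := by ring
        _ ≤ 2 * (n + 1) * Real.log r * (2 * D * s / r) := by gcongr
        _ = _ := by ring
    have hyr : 1 / r ≤ y := by
      rw [hy]
      have : (0 : ℝ) ≤ n := by positivity
      gcongr
      nlinarith
    have hcosh : Real.cosh y - 1 ≤ B ^ 2 * Real.exp (B ^ 2) * (Real.log r ^ 2 / r ^ 2) := by
      refine (Real.cosh_sub_one_le hy0 (B := B) ?_).trans ?_
      · exact hyB.trans (mul_le_of_le_one_right hB0 ((div_le_one hr0).2 hlogr))
      · calc _ ≤ (B * (Real.log r / r)) ^ 2 * Real.exp (B ^ 2) := by gcongr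
          _ = _ := by ring
    set g : MvPolynomial (Fin n) ℝ :=
      MvPolynomial.C (Real.cosh y) - MvPolynomial.C (1 / M) * (f - MvPolynomial.C (F a)) with hg
    set p : MvPolynomial (Fin n) ℝ := Polynomial.aeval g (Polynomial.Chebyshev.T ℝ s) with hp
    have hgdeg : g.totalDegree ≤ D := by
      refine (MvPolynomial.totalDegree_sub _ _).trans (max_le (by simp) ?_)
      refine (MvPolynomial.totalDegree_mul _ _).trans ?_
      have := MvPolynomial.totalDegree_sub f (MvPolynomial.C (F a))
      simp only [MvPolynomial.totalDegree_C] at this ⊢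
      omega
    have hpdeg : p.totalDegree ≤ r := by
      refine (MvPolynomial.totalDegree_aeval_le _ _).trans (le_trans ?_ hsD)
      exact Nat.mul_le_mul (by simp) hgdeg
    have hpe (x : EuclideanSpace ℝ (Fin n)) : MvPolynomial.eval (fun i => x i) p =
        (Polynomial.Chebyshev.T ℝ s).eval (Real.cosh y - (F x - F a) / M) := by
      have h1 : MvPolynomial.eval (fun i => x i) g = Real.cosh y - (F x - F a) / M := by
        simp only [hg, map_sub, map_mul, MvPolynomial.eval_C, ← hF]
        ring
      rw [← h1, hp, Polynomial.aeval_def, Polynomial.hom_eval₂,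
        Subsingleton.elim (RingHom.comp _ _) (RingHom.id ℝ), Polynomial.eval₂_id]
    have hpc : Continuous fun x : EuclideanSpace ℝ (Fin n) =>
        (MvPolynomial.eval (fun i => x i) p) ^ 2 :=
      (contDiff_eval_mvPolynomial p).continuous.pow 2
    set ε : ℝ := 1 / (4 * (L + 1) * r ^ 2) with hε
    have hε0 : 0 < ε := by positivity
    have hε1 : ε ≤ 1 := by
      rw [hε, div_le_one (by positivity)]
      nlinarith
    have hexp : Real.exp (s * y) = (r : ℝ) ^ (2 * (n + 1)) := by
      have : (s : ℝ) * y = ((2 * (n + 1) : ℕ) : ℝ) * Real.log r := by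
        rw [hy]
        push_cast
        field_simp
      rw [this, Real.exp_nat_mul, Real.exp_log hr0]
    have hint := pow_mul_le_setIntegral (c := Real.exp (s * y) / 4) hKc hKconv ha hpc
      (fun x => sq_nonneg _) hε0.le hε1 fun x hx => by
        rw [hpe]
        refine exp_div_four_le_sq_eval_chebyshev s hy0 ?_
        have h1 := hL ε hε0.le hε1 x hx
        have h2 : L * ε ≤ 1 / 4 * (1 / r) ^ 2 := by
          calc L * ε ≤ (L + 1) * ε := by gcongr; linarith
            _ = _ := by rw [hε]; field_simp
        have h3 : (1 / (r : ℝ)) ^ 2 ≤ y ^ 2 := by gcongr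
        rw [div_le_iff₀ (by linarith)]
        nlinarith [sq_nonneg y]
    set I := ∫ x in K, (MvPolynomial.eval (fun i => x i) p) ^ 2 with hI
    have hlow : Real.exp (s * y) / 4 * (ε ^ n * volume.real K) =
        r ^ 2 * volume.real K / (4 * (4 * (L + 1)) ^ n) := by
      rw [hexp, hε, div_pow, one_pow, mul_pow _ ((r : ℝ) ^ 2), ← pow_mul, mul_add, pow_add]
      field_simp
    rw [hlow] at hint
    have hI0 : 0 < I := lt_of_lt_of_le (by positivity) hint
    have hratio : volume.real K / I ≤ 16 * (4 * (L + 1)) ^ n * (Real.log r ^ 2 / r ^ 2) := by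
      rw [div_le_iff₀ hI0]
      calc volume.real K ≤ (4 * Real.log r ^ 2) * volume.real K :=
            le_mul_of_one_le_left hV.le hlog2
        _ = 16 * (4 * (L + 1)) ^ n * (Real.log r ^ 2 / r ^ 2) *
            (r ^ 2 * volume.real K / (4 * (4 * (L + 1)) ^ n)) := by
          field_simp
          norm_num
        _ ≤ _ := by gcongr
    have h := lasserreError_le (α := M * (Real.cosh y - 1)) (β := M) hKc hFc ha hmin hpdeg hI0
      fun x hx => by
        rw [hpe]
        have h1 := mul_sq_eval_chebyshev_le s y (t := (F x - F a) / M)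
          ((div_le_one (by linarith)).2 (by linarith [hmax x hx]))
        have h2 := mul_le_mul_of_nonneg_left h1 (show 0 ≤ M by linarith)
        rw [← mul_assoc, mul_div_cancel₀ _ (by linarith : M ≠ 0)] at h2
        linarith
    refine h.trans ?_
    rw [← hI, mul_div_assoc, ← mul_add]
    calc _ ≤ M * (B ^ 2 * Real.exp (B ^ 2) * (Real.log r ^ 2 / r ^ 2) +
          16 * (4 * (L + 1)) ^ n * (Real.log r ^ 2 / r ^ 2)) := by gcongr
      _ = M * (B ^ 2 * Real.exp (B ^ 2) + 16 * (4 * (L + 1)) ^ n + 0) *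
          Real.log r ^ 2 / r ^ 2 := by ring
      _ ≤ _ := by
        gcongr
        positivity
end
end
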